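/- Let 𝔽_q be a finite field with q elements, n ≥ 2, and let F ∈ 𝔽_q[x₀,…,xₙ] be a homogeneous polynomial of degree δ ≥ 4 whose image in K[x₀,…,xₙ], where K is an algebraic closure of 𝔽_q, is irreducible (i.e., the hypersurface X = {F = 0} is geometrically irreducible). If q > ((1+√2)/2)^2 · δ² · (δ-1)² · (δ-2)², then there exist linearly independent vectors P, Q ∈ 𝔽_q^{n+1} such that for every pair (a,b) ∈ 𝔽_q² with (a,b) ≠ (0,0) one has F(aP + bQ) ≠ 0; that is, there is an 𝔽_q-line L ⊂ ℙⁿ such that X ∩ L contains no 𝔽_q-points. -/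

import Mathlib

namespace LineAvoid
open Polynomial

section Hensel
variable {A : Type*} [CommRing A]

lemma exists_hensel_root (f : A[X][X]) (hf : f.Monic) (x0 y0 : A)
    (h0 : (f.map (evalRingHom x0)).eval y0 = 0)
    (h1 : IsUnit ((f.map (evalRingHom x0)).derivative.eval y0)) :
    ∃ Y : PowerSeries A, PowerSeries.constantCoeff Y = y0 ∧
      (f.map (eval₂RingHom (PowerSeries.C (R := A)) (PowerSeries.C x0 + PowerSeries.X))).eval Y = 0 := by
  set φ : A[X] →+* PowerSeries A :=
    eval₂RingHom (PowerSeries.C (R := A)) (PowerSeries.C x0 + PowerSeries.X) with hφ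
  have hc : (PowerSeries.constantCoeff (R := A)).comp φ = evalRingHom x0 := by
    ext <;> simp [hφ]
  have key : ∀ g : A[X][X], PowerSeries.constantCoeff ((g.map φ).eval (PowerSeries.C y0))
      = (g.map (evalRingHom x0)).eval y0 := by
    intro g
    rw [← hc, ← Polynomial.map_map, ← Polynomial.eval_map_apply]
    simp
  have H := HenselianRing.is_henselian (I := Ideal.span {(PowerSeries.X : PowerSeries A)})
    (f.map φ) (hf.map φ) (PowerSeries.C y0) (by
      rw [Ideal.mem_span_singleton, PowerSeries.X_dvd_iff, key, h0]) (by
      apply IsUnit.map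
      rw [PowerSeries.isUnit_iff_constantCoeff, Polynomial.derivative_map, key,
        ← Polynomial.derivative_map]
      exact h1)
  obtain ⟨Y, hY, hY2⟩ := H
  refine ⟨Y, ?_, hY⟩
  rw [Ideal.mem_span_singleton, PowerSeries.X_dvd_iff] at hY2
  simpa [sub_eq_zero] using hY2

end Hensel

section Fil
variable {K A : Type*} [Field K] [CommRing A] [Algebra K A]

/-- span of monomials of degree at most `D` in two elements -/
def fil2 (K : Type*) {A : Type*} [Field K] [CommRing A] [Algebra K A] (x y : A) (D : ℤ) :
    Submodule K A :=
  Submodule.span K {z | ∃ a b : ℕ, (a : ℤ) + b ≤ D ∧ z = x ^ a * y ^ b}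

lemma fil2_mono {x y : A} {D E : ℤ} (h : D ≤ E) : fil2 K x y D ≤ fil2 K x y E := by
  apply Submodule.span_mono
  rintro z ⟨a, b, hab, rfl⟩
  exact ⟨a, b, hab.trans h, rfl⟩

lemma fil2_mem {x y : A} {D : ℤ} (a b : ℕ) (h : (a : ℤ) + b ≤ D) :
    x ^ a * y ^ b ∈ fil2 K x y D := Submodule.subset_span ⟨a, b, h, rfl⟩

lemma fil2_mul {x y : A} {D E : ℤ} {p r : A} (hp : p ∈ fil2 K x y D) (hr : r ∈ fil2 K x y E) :
    p * r ∈ fil2 K x y (D + E) := by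
  have h := Submodule.mul_mem_mul hp hr
  rw [fil2, fil2, Submodule.span_mul_span] at h
  refine Submodule.span_mono ?_ h
  rintro _ ⟨_, ⟨a, b, hab, rfl⟩, _, ⟨a', b', hab', rfl⟩, rfl⟩
  exact ⟨a + a', b + b', by push_cast; linarith, by ring⟩

end Fil

section Curve
variable {K : Type*} [Field K]

/-- plane curve, monic in the outer variable, total degree `d` -/
structure IsCurve (f : K[X][X]) (d : ℕ) : Prop where
  monic : f.Monic
  deg : f.natDegree = d
  tot : ∀ i j, d < i + j → (f.coeff j).coeff i = 0
  irr : Irreducible f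

variable {f : K[X][X]} {d : ℕ}

/-- the x-coordinate -/
noncomputable abbrev cx (f : K[X][X]) : AdjoinRoot f := AdjoinRoot.of f X
/-- the y-coordinate -/
noncomputable abbrev cy (f : K[X][X]) : AdjoinRoot f := AdjoinRoot.root f

/-- reduced exponents -/
def red (d D : ℕ) : Finset (ℕ × ℕ) :=
  ((Finset.range (D + 1)) ×ˢ (Finset.range d)).filter (fun p => p.1 + p.2 ≤ D)

lemma mem_red {D : ℕ} {p : ℕ × ℕ} : p ∈ red d D ↔ p.2 < d ∧ p.1 + p.2 ≤ D := by
  simp [red]; omega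

lemma card_red (d D : ℕ) : (red d D).card = ∑ b ∈ Finset.range d, (D + 1 - b) := by
  rw [red, Finset.card_filter, Finset.sum_product_right]
  apply Finset.sum_congr rfl
  intro b _
  rw [← Finset.card_filter]
  have : (Finset.range (D + 1)).filter (fun a => a + b ≤ D) = Finset.range (D + 1 - b) := by
    ext a; simp; omega
  rw [this, Finset.card_range]

lemma card_red_add (d M D : ℕ) (h : d ≤ M + 1) :
    (red d (M + D)).card = (red d M).card + d * D := by
  rw [card_red, card_red]
  have : ∀ b ∈ Finset.range d, (M + D + 1 - b) = (M + 1 - b) + D := by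
    intro b hb
    rw [Finset.mem_range] at hb
    omega
  rw [Finset.sum_congr rfl this, Finset.sum_add_distrib]
  simp

lemma card_red_lower (d D : ℕ) : (d : ℤ) * D - d * d ≤ (red d D).card := by
  rw [card_red]
  push_cast
  have : ∀ b ∈ Finset.range d, ((D : ℤ) - d) ≤ ((D + 1 - b : ℕ) : ℤ) := by
    intro b hb
    rw [Finset.mem_range] at hb
    omega
  calc (d : ℤ) * D - d * d = ∑ b ∈ Finset.range d, ((D : ℤ) - d) := by simp
    _ ≤ _ := Finset.sum_le_sum this

lemma of_eq_sum (p : K[X]) (n : ℕ) (hn : p.natDegree ≤ n) :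
    AdjoinRoot.of f p = ∑ i ∈ Finset.range (n + 1), p.coeff i • (cx f) ^ i := by
  conv_lhs => rw [p.as_sum_range' (n + 1) (by omega)]
  rw [map_sum]
  refine Finset.sum_congr rfl fun i _ => ?_
  rw [← C_mul_X_pow_eq_monomial, map_mul, map_pow, Algebra.smul_def]
  rfl

lemma natDegree_coeff_le (hf : IsCurve f d) (j : ℕ) : (f.coeff j).natDegree ≤ d - j := by
  rw [natDegree_le_iff_coeff_eq_zero]
  intro i hi
  exact hf.tot i j (by omega)

lemma cy_pow_eq (hf : IsCurve f d) :
    (cy f) ^ d = - ∑ j ∈ Finset.range d, ∑ i ∈ Finset.range (d - j + 1),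
      (f.coeff j).coeff i • ((cx f) ^ i * (cy f) ^ j) := by
  have h := AdjoinRoot.eval₂_root f
  rw [eval₂_eq_sum_range, Finset.sum_range_succ, hf.monic.coeff_natDegree, hf.deg] at h
  simp only [map_one, one_mul] at h
  rw [eq_neg_iff_add_eq_zero, ← h, add_comm]
  congr 1
  refine Finset.sum_congr rfl fun j hj => ?_
  rw [of_eq_sum _ (d - j) (natDegree_coeff_le hf j), Finset.sum_mul]
  refine Finset.sum_congr rfl fun i hi => ?_
  rw [smul_mul_assoc]

/-- the span of reduced monomials -/
lemma fil2_le_red (hf : IsCurve f d) (D : ℕ) :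
    fil2 K (cx f) (cy f) D ≤
      Submodule.span K ((fun p : ℕ × ℕ => (cx f) ^ p.1 * (cy f) ^ p.2) '' (red d D : Set (ℕ × ℕ))) := by
  rw [fil2, Submodule.span_le]
  rintro z ⟨a, b, hab, rfl⟩
  have hab' : a + b ≤ D := by exact_mod_cast hab
  clear hab
  induction b using Nat.strong_induction_on generalizing a with
  | _ b ih =>
    by_cases hb : b < d
    · exact Submodule.subset_span ⟨(a, b), by simp [mem_red]; omega, rfl⟩
    · obtain ⟨c, rfl⟩ := Nat.exists_eq_add_of_le (not_lt.1 hb)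
      have : (cx f) ^ a * (cy f) ^ (d + c) = - ∑ j ∈ Finset.range d, ∑ i ∈ Finset.range (d - j + 1),
          (f.coeff j).coeff i • ((cx f) ^ (a + i) * (cy f) ^ (j + c)) := by
        rw [pow_add (cy f), cy_pow_eq hf, neg_mul, mul_neg, Finset.sum_mul, Finset.mul_sum]
        congr 1
        refine Finset.sum_congr rfl fun j hj => ?_
        rw [Finset.sum_mul, Finset.mul_sum]
        refine Finset.sum_congr rfl fun i hi => ?_
        rw [smul_mul_assoc, mul_smul_comm]
        congr 1
        ring
      rw [this]
      refine Submodule.neg_mem _ (Submodule.sum_mem _ fun j hj => Submodule.sum_mem _ fun i hi => ?_)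
      rw [Finset.mem_range] at hi hj
      refine Submodule.smul_mem _ _ (ih (j + c) (by omega) (a + i) (by omega))


lemma fil2_finite (hf : IsCurve f d) (D : ℕ) : Module.Finite K (fil2 K (cx f) (cy f) D) := by
  have : Module.Finite K (Submodule.span K ((fun p : ℕ × ℕ => (cx f) ^ p.1 * (cy f) ^ p.2) '' (red d D : Set (ℕ × ℕ)))) :=
    FiniteDimensional.span_of_finite K ((red d D).finite_toSet.image _)
  exact Submodule.finiteDimensional_of_le (fil2_le_red hf D)

lemma finrank_fil2_le (hf : IsCurve f d) (D : ℕ) :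
    Module.finrank K (fil2 K (cx f) (cy f) D) ≤ (red d D).card := by
  classical
  have h1 := fil2_le_red hf D
  rw [← Finset.coe_image] at h1
  calc _ ≤ _ := Submodule.finrank_mono h1
    _ ≤ _ := finrank_span_finset_le_card _
    _ ≤ _ := Finset.card_image_le

lemma red_indep (hf : IsCurve f d) (s : Finset (ℕ × ℕ)) (hs : ∀ p ∈ s, p.2 < d) (c : ℕ × ℕ → K)
    (h : ∑ p ∈ s, c p • ((cx f) ^ p.1 * (cy f) ^ p.2) = 0) : ∀ p ∈ s, c p = 0 := by
  set g : K[X][X] := ∑ p ∈ s, monomial p.2 (monomial p.1 (c p)) with hg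
  have hmk : AdjoinRoot.mk f g = 0 := by
    rw [← h, hg, map_sum]
    refine Finset.sum_congr rfl fun p _ => ?_
    rw [← C_mul_X_pow_eq_monomial, ← C_mul_X_pow_eq_monomial, map_mul, map_pow, AdjoinRoot.mk_X,
      AdjoinRoot.mk_C, map_mul, map_pow, Algebra.smul_def, mul_assoc]
    rfl
  have hg0 : g = 0 := by
    by_contra hne
    refine AdjoinRoot.mk_ne_zero_of_degree_lt hf.monic hne ?_ hmk
    rw [degree_eq_natDegree hf.monic.ne_zero, hf.deg, hg]
    refine (degree_sum_le _ _).trans_lt ?_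
    refine (Finset.sup_lt_iff (WithBot.bot_lt_coe d)).2 fun p hp => ?_
    exact (degree_monomial_le _ _).trans_lt (WithBot.coe_lt_coe.2 (hs p hp))
  intro p hp
  have := congrArg (fun g => (coeff g p.2).coeff p.1) hg0
  simp only [hg, finsetSum_coeff, coeff_zero] at this
  rw [Finset.sum_eq_single p] at this
  · simpa using this
  · rintro b hb hbp
    rw [coeff_monomial]
    split_ifs with h1
    · rw [coeff_monomial]
      split_ifs with h2
      · exact absurd (Prod.ext h2 h1) hbp
      · rfl
    · simp
  · intro h; exact absurd hp h

lemma le_finrank_fil2 (hf : IsCurve f d) (D : ℕ) :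
    (red d D).card ≤ Module.finrank K (fil2 K (cx f) (cy f) D) := by
  have := fil2_finite hf D
  have hli : LinearIndependent K (fun p : red d D =>
      (⟨(cx f) ^ p.1.1 * (cy f) ^ p.1.2, fil2_mem _ _ (by
        have := (mem_red.1 p.2).2; exact_mod_cast this)⟩ : fil2 K (cx f) (cy f) D)) := by
    rw [Fintype.linearIndependent_iff]
    intro g hg p
    have := congrArg (Submodule.subtype _) hg
    rw [map_sum] at this
    simp only [map_smul, Submodule.subtype_apply, map_zero] at this
    have h2 := red_indep hf (red d D) (fun p hp => (mem_red.1 hp).1)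
      (fun p => if h : p ∈ red d D then g ⟨p, h⟩ else 0) (by
        rw [← this, ← Finset.sum_coe_sort]
        refine Finset.sum_congr rfl fun p _ => ?_
        simp) p.1 p.2
    simpa using h2
  simpa using hli.fintype_card_le_finrank

lemma exists_mem_fil2 (f : K[X][X]) (r : AdjoinRoot f) : ∃ D : ℕ, r ∈ fil2 K (cx f) (cy f) D := by
  obtain ⟨p, rfl⟩ := AdjoinRoot.mk_surjective r
  induction p using Polynomial.induction_on' with
  | add p q hp hq =>
    obtain ⟨D, hD⟩ := hp
    obtain ⟨E, hE⟩ := hq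
    refine ⟨max D E, ?_⟩
    rw [map_add]
    exact Submodule.add_mem _ (fil2_mono (by simp) hD) (fil2_mono (by simp) hE)
  | monomial n a =>
    refine ⟨a.natDegree + n, ?_⟩
    rw [← C_mul_X_pow_eq_monomial, map_mul, map_pow, AdjoinRoot.mk_X, AdjoinRoot.mk_C,
      of_eq_sum a a.natDegree le_rfl, Finset.sum_mul]
    refine Submodule.sum_mem _ fun i hi => ?_
    rw [smul_mul_assoc]
    refine Submodule.smul_mem _ _ (fil2_mem _ _ ?_)
    rw [Finset.mem_range] at hi
    push_cast
    omega

end Curve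
end LineAvoid

namespace LineAvoid
open Polynomial
section Bezout
variable {K : Type*} [Field K] {f : K[X][X]} {d : ℕ}

theorem bezout_bound (hf : IsCurve f d) (D : ℕ) (c : AdjoinRoot f) (hc0 : c ≠ 0)
    (hcD : c ∈ fil2 K (cx f) (cy f) D) {ι : Type*} [Fintype ι]
    (θ : ι → (AdjoinRoot f →ₐ[K] PowerSeries K)) (e : ι → ℕ)
    (hsep : ∀ i j, i ≠ j → ∃ s, PowerSeries.X ∣ θ j s ∧ PowerSeries.constantCoeff (θ i s) ≠ 0)
    (hloc : ∀ i, ∀ n < e i, ∃ w, PowerSeries.X ^ n ∣ θ i w ∧ PowerSeries.coeff n (θ i w) ≠ 0)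
    (hc : ∀ i, PowerSeries.X ^ (e i) ∣ θ i c) :
    ∑ i, e i ≤ d * D := by
  classical
  have : Fact (Irreducible f) := ⟨hf.irr⟩
  have hdom : IsDomain (AdjoinRoot f) := AdjoinRoot.isDomain_of_prime hf.irr.prime
  -- separating elements
  have hW : ∀ p : (Σ i, Fin (e i)), ∃ w : AdjoinRoot f,
      PowerSeries.X ^ (p.2 : ℕ) ∣ θ p.1 w ∧ PowerSeries.coeff (p.2 : ℕ) (θ p.1 w) ≠ 0 ∧
      ∀ j, j ≠ p.1 → PowerSeries.X ^ (e j) ∣ θ j w := by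
    rintro ⟨i, n, hn⟩
    obtain ⟨w, hw1, hw2⟩ := hloc i n hn
    choose s hs1 hs2 using fun j : {j // i ≠ j} => hsep i j.1 j.2
    set t : ι → AdjoinRoot f := fun j => if h : i ≠ j then s ⟨j, h⟩ ^ (e j) else 1 with ht
    have ht0 : ∀ j, PowerSeries.constantCoeff (θ i (t j)) ≠ 0 := by
      intro j
      simp only [ht]
      split_ifs with h
      · rw [map_pow, map_pow]; exact pow_ne_zero _ (hs2 ⟨j, h⟩)
      · simp
    refine ⟨w * ∏ j, t j, ?_, ?_, ?_⟩
    · rw [map_mul]; exact hw1.mul_right _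
    · obtain ⟨v, hv⟩ := hw1
      simp only at hv hw2 ⊢
      rw [map_mul, hv, mul_assoc, PowerSeries.coeff_X_pow_mul']
      rw [hv, PowerSeries.coeff_X_pow_mul'] at hw2
      simp only [le_refl, if_true, Nat.sub_self, PowerSeries.coeff_zero_eq_constantCoeff] at hw2 ⊢
      rw [map_mul, map_prod, map_prod]
      exact mul_ne_zero hw2 (Finset.prod_ne_zero_iff.2 fun j _ => ht0 j)
    · intro j hj
      simp only at hj
      rw [map_mul, map_prod]
      refine (Dvd.dvd.mul_left ?_ _)
      refine Dvd.dvd.trans ?_ (Finset.dvd_prod_of_mem _ (Finset.mem_univ j))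
      simp only [ht]
      rw [dif_pos hj.symm, map_pow]
      exact pow_dvd_pow_of_dvd (hs1 ⟨j, hj.symm⟩) _
  choose W hW1 hW2 hW3 using hW
  choose DW hDW using fun p => exists_mem_fil2 f (W p)
  set M : ℕ := d + ∑ p, DW p with hM
  have hWM : ∀ p, W p ∈ fil2 K (cx f) (cy f) ((M + D : ℕ) : ℤ) := by
    intro p
    refine fil2_mono ?_ (hDW p)
    have := Finset.single_le_sum (f := DW) (fun _ _ => Nat.zero_le _) (Finset.mem_univ p)
    exact_mod_cast (by omega : DW p ≤ M + D)
  have fin1 := fil2_finite hf (M + D)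
  have fin2 := fil2_finite hf M
  let J : fil2 K (cx f) (cy f) ((M + D : ℕ) : ℤ) →ₗ[K] ((Σ i, Fin (e i)) → K) :=
    LinearMap.pi fun p => (PowerSeries.coeff (p.2 : ℕ)).comp
      ((θ p.1).toLinearMap.comp (Submodule.subtype _))
  have hJ : ∀ r p, J r p = PowerSeries.coeff (p.2 : ℕ) (θ p.1 r.1) := fun _ _ => rfl
  -- kernel is big
  have hker : (red d M).card ≤ Module.finrank K (LinearMap.ker J) := by
    refine (le_finrank_fil2 hf M).trans ?_
    let m : fil2 K (cx f) (cy f) (M : ℤ) →ₗ[K] LinearMap.ker J :=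
      LinearMap.codRestrict _ (LinearMap.codRestrict _
        ((LinearMap.mulLeft K c).comp (Submodule.subtype _)) (by
          intro r
          have := fil2_mul hcD r.2
          rw [add_comm] at this
          simpa using this)) (by
        intro r
        rw [LinearMap.mem_ker]
        ext p
        rw [hJ]
        simp only [LinearMap.codRestrict_apply, LinearMap.comp_apply, Submodule.subtype_apply,
          LinearMap.mulLeft_apply, Pi.zero_apply, map_mul]
        exact (PowerSeries.X_pow_dvd_iff.1 ((hc p.1).mul_right _)) _ p.2.2)
    refine LinearMap.finrank_le_finrank_of_injective (f := m) ?_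
    intro r r' hrr
    have h1 := congrArg (fun z => ((z : LinearMap.ker J) : fil2 K (cx f) (cy f) ((M + D : ℕ) : ℤ)).1) hrr
    have h2 : c * r.1 = c * r'.1 := h1
    exact Subtype.ext (mul_left_cancel₀ hc0 h2)
  have hrange : ∑ i, e i ≤ Module.finrank K (LinearMap.range J) := by
    have hli : LinearIndependent K (fun p : (Σ i, Fin (e i)) =>
        (⟨J ⟨W p, hWM p⟩, LinearMap.mem_range_self _ _⟩ : LinearMap.range J)) := by
      rw [Fintype.linearIndependent_iff]
      intro g hg
      have hg' : ∀ p : (Σ i, Fin (e i)), ∑ p', g p' * PowerSeries.coeff (p.2 : ℕ) (θ p.1 (W p')) = 0 := by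
        intro p
        have := congrArg (fun z : LinearMap.range J => z.1 p) hg
        simpa [hJ] using this
      rintro ⟨i, n, hn⟩
      induction n using Nat.strong_induction_on with
      | _ n ih =>
        have h := hg' ⟨i, n, hn⟩
        rw [Finset.sum_eq_single (⟨i, n, hn⟩ : Σ i, Fin (e i))] at h
        · exact (mul_eq_zero.1 h).resolve_right (hW2 ⟨i, n, hn⟩)
        · rintro ⟨j, m, hm⟩ _ hne
          by_cases hji : j = i
          · subst hji
            rcases lt_trichotomy m n with hmn | hmn | hmn
            · rw [ih m hmn hm, zero_mul]
            · subst hmn; exact absurd rfl hne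
            · rw [(PowerSeries.X_pow_dvd_iff.1 (hW1 ⟨j, m, hm⟩)) n hmn, mul_zero]
          · rw [(PowerSeries.X_pow_dvd_iff.1 (hW3 ⟨j, m, hm⟩ i (Ne.symm hji))) n hn, mul_zero]
        · intro h; exact absurd (Finset.mem_univ _) h
    have := hli.fintype_card_le_finrank
    simpa using this
  have h1 := LinearMap.finrank_range_add_finrank_ker J
  have h2 := finrank_fil2_le hf (M + D)
  rw [card_red_add d M D (by omega)] at h2
  omega

end Bezout

section Points
variable {K : Type*} [Field K] {f : K[X][X]} {d : ℕ}

/-- value of `f` at a point of the plane -/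
noncomputable def fval (f : K[X][X]) (x0 y0 : K) : K := (f.map (evalRingHom x0)).eval y0

lemma exists_ev (f : K[X][X]) (x0 y0 : K) (h : fval f x0 y0 = 0) :
    ∃ φ : AdjoinRoot f →ₐ[K] K, φ (cx f) = x0 ∧ φ (cy f) = y0 := by
  refine ⟨AdjoinRoot.liftAlgHom f (aeval x0) y0 ?_, ?_, ?_⟩
  · rw [fval, eval_map] at h
    rw [← h]
    congr 1
  · simp
  · simp

lemma exists_theta (hf : f.Monic) (x0 y0 : K) (h : fval f x0 y0 = 0)
    (h' : fval (derivative f) x0 y0 ≠ 0) :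
    ∃ θ : AdjoinRoot f →ₐ[K] PowerSeries K, θ (cx f) = PowerSeries.C x0 + PowerSeries.X ∧
      PowerSeries.constantCoeff (θ (cy f)) = y0 := by
  obtain ⟨Y, hY, hY2⟩ := exists_hensel_root f hf x0 y0 h (by
    rw [derivative_map]; exact isUnit_iff_ne_zero.2 h')
  refine ⟨AdjoinRoot.liftAlgHom f (aeval (PowerSeries.C x0 + PowerSeries.X)) Y ?_, ?_, ?_⟩
  · rw [eval_map] at hY2
    rw [← hY2]
    congr 1
  · simp
  · simpa using hY

/-- Bezout: a nonzero function of degree `D` has at most `d * D` zeros. -/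
lemma card_zeros_le (hf : IsCurve f d) (D : ℕ) (c : AdjoinRoot f) (hc0 : c ≠ 0)
    (hcD : c ∈ fil2 K (cx f) (cy f) D) (S : Finset (K × K))
    (hS : ∀ p ∈ S, ∃ φ : AdjoinRoot f →ₐ[K] K, φ (cx f) = p.1 ∧ φ (cy f) = p.2 ∧ φ c = 0) :
    S.card ≤ d * D := by
  choose φ h1 h2 h3 using fun p : S => hS p.1 p.2
  have := bezout_bound hf D c hc0 hcD (ι := S)
    (fun p => (Algebra.ofId K (PowerSeries K)).comp (φ p)) (fun _ => 1) ?_ ?_ ?_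
  · simpa using this
  · intro i j hij
    have : i.1.1 ≠ j.1.1 ∨ i.1.2 ≠ j.1.2 := by
      by_contra hcon
      push Not at hcon
      exact hij (Subtype.ext (Prod.ext hcon.1 hcon.2))
    rcases this with h | h
    · refine ⟨cx f - algebraMap K _ j.1.1, ?_, ?_⟩
      · simp [h1]
      · simp [h1, Algebra.ofId_apply, sub_ne_zero, h]
    · refine ⟨cy f - algebraMap K _ j.1.2, ?_, ?_⟩
      · simp [h2]
      · simp [h2, Algebra.ofId_apply, sub_ne_zero, h]
  · intro i n hn
    refine ⟨1, ?_, ?_⟩ <;> (have : n = 0 := by omega) <;> subst this <;> simp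
  · intro i
    simp [h3]

/-- Bezout with multiplicities at smooth points. -/
lemma bezout_smooth (hf : IsCurve f d) (D : ℕ) (c : AdjoinRoot f) (hc0 : c ≠ 0)
    (hcD : c ∈ fil2 K (cx f) (cy f) D) {ι : Type*} [Fintype ι] (pt : ι → K × K)
    (hpt : Function.Injective pt)
    (θ : ι → (AdjoinRoot f →ₐ[K] PowerSeries K)) (e : ι → ℕ)
    (h1 : ∀ i, θ i (cx f) = PowerSeries.C (pt i).1 + PowerSeries.X)
    (h2 : ∀ i, PowerSeries.constantCoeff (θ i (cy f)) = (pt i).2)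
    (hc : ∀ i, PowerSeries.X ^ (e i) ∣ θ i c) :
    ∑ i, e i ≤ d * D := by
  have hal : ∀ (i : ι) (z : K), θ i (algebraMap K _ z) = PowerSeries.C z := by
    intro i z
    rw [AlgHom.commutes]; rfl
  refine bezout_bound hf D c hc0 hcD θ e ?_ ?_ hc
  · intro i j hij
    have : (pt i).1 ≠ (pt j).1 ∨ (pt i).2 ≠ (pt j).2 := by
      by_contra hcon
      push Not at hcon
      exact hij (hpt (Prod.ext hcon.1 hcon.2))
    rcases this with h | h
    · refine ⟨cx f - algebraMap K _ (pt j).1, ?_, ?_⟩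
      · rw [map_sub, hal, h1]; simp
      · rw [map_sub, hal, h1]; simpa [sub_eq_zero] using h
    · refine ⟨cy f - algebraMap K _ (pt j).2, ?_, ?_⟩
      · rw [map_sub, hal, PowerSeries.X_dvd_iff]; simp [h2]
      · rw [map_sub, hal]; simpa [sub_eq_zero, h2] using h
  · intro i n hn
    refine ⟨(cx f - algebraMap K _ (pt i).1) ^ n, ?_, ?_⟩
    · rw [map_pow, map_sub, hal, h1]; simp
    · rw [map_pow, map_sub, hal, h1]; simp

end Points
end LineAvoid

namespace LineAvoid
open Polynomial
section Ev
variable {K : Type*} [Field K] {A A' : Type*} [CommRing A] [Algebra K A] [CommRing A'] [Algebra K A']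

/-- evaluation of a bivariate polynomial -/
noncomputable def ev2 (f : K[X][X]) (ξ η : A) : A :=
  f.eval₂ ((aeval ξ : K[X] →ₐ[K] A) : K[X] →+* A) η

/-- divided difference in the second variable -/
noncomputable def bdd (f : K[X][X]) (ξ y η : A) : A :=
  ∑ j ∈ Finset.range (f.natDegree + 1), aeval ξ (f.coeff j) *
    ∑ a ∈ Finset.range j, y ^ a * η ^ (j - 1 - a)

/-- divided difference in the first variable -/
noncomputable def add1 (f : K[X][X]) (x ξ y : A) : A :=
  ∑ j ∈ Finset.range (f.natDegree + 1), (∑ i ∈ Finset.range ((f.coeff j).natDegree + 1),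
    algebraMap K A ((f.coeff j).coeff i) * ∑ a ∈ Finset.range i, x ^ a * ξ ^ (i - 1 - a)) * y ^ j

lemma ev2_eq (f : K[X][X]) (ξ η : A) :
    ev2 f ξ η = ∑ j ∈ Finset.range (f.natDegree + 1), aeval ξ (f.coeff j) * η ^ j := by
  rw [ev2, eval₂_eq_sum_range]; rfl

lemma map_ev2 (φ : A →ₐ[K] A') (f : K[X][X]) (ξ η : A) : φ (ev2 f ξ η) = ev2 f (φ ξ) (φ η) := by
  simp [ev2_eq, aeval_algHom_apply]

lemma map_bdd (φ : A →ₐ[K] A') (f : K[X][X]) (ξ y η : A) :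
    φ (bdd f ξ y η) = bdd f (φ ξ) (φ y) (φ η) := by
  simp [bdd, aeval_algHom_apply]

lemma bdd_mul (f : K[X][X]) (ξ y η : A) :
    bdd f ξ y η * (y - η) = ev2 f ξ y - ev2 f ξ η := by
  rw [bdd, ev2_eq, ev2_eq, ← Finset.sum_sub_distrib, Finset.sum_mul]
  refine Finset.sum_congr rfl fun j _ => ?_
  rw [mul_assoc, (Commute.all y η).geom_sum₂_mul, mul_sub]

lemma add1_mul (f : K[X][X]) (x ξ y : A) :
    add1 f x ξ y * (x - ξ) = ev2 f x y - ev2 f ξ y := by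
  rw [add1, ev2_eq, ev2_eq, ← Finset.sum_sub_distrib, Finset.sum_mul]
  refine Finset.sum_congr rfl fun j _ => ?_
  rw [aeval_eq_sum_range, aeval_eq_sum_range, ← sub_mul, ← Finset.sum_sub_distrib, mul_right_comm,
    Finset.sum_mul]
  congr 1
  refine Finset.sum_congr rfl fun i _ => ?_
  rw [mul_assoc, (Commute.all x ξ).geom_sum₂_mul, mul_sub, Algebra.smul_def, Algebra.smul_def]

lemma bdd_diag (f : K[X][X]) (ξ η : A) : bdd f ξ η η = ev2 (derivative f) ξ η := by
  rw [ev2, derivative_apply, bdd, sum_over_range' _ _ (f.natDegree + 1) (by omega), eval₂_finsetSum]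
  · refine Finset.sum_congr rfl fun j _ => ?_
    rw [Finset.sum_congr rfl (g := fun _ => η ^ (j - 1))]
    · simp [mul_assoc]
    · intro a ha
      rw [Finset.mem_range] at ha
      rw [← pow_add]; congr 1; omega
  · simp

lemma ev2_K (f : K[X][X]) (x0 y0 : K) : ev2 f x0 y0 = fval f x0 y0 := by
  rw [ev2, fval, eval_map]
  congr 1

end Ev

section Surf
variable {K : Type*} [Field K] (f : K[X][X]) {d : ℕ}

/-- the defining polynomial over the coordinate ring -/
noncomputable abbrev fS : (AdjoinRoot f)[X][X] := f.map (mapRingHom (algebraMap K (AdjoinRoot f)))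

/-- the coordinate ring of the square of the curve -/
abbrev SS := AdjoinRoot (fS f)

/-- second x-coordinate -/
noncomputable abbrev sx : SS f := AdjoinRoot.of (fS f) X
/-- second y-coordinate -/
noncomputable abbrev sy : SS f := AdjoinRoot.root (fS f)
/-- inclusion of the first factor -/
noncomputable abbrev inc : AdjoinRoot f →ₐ[K] SS f := IsScalarTower.toAlgHom K (AdjoinRoot f) (SS f)

variable {f}

lemma ev2_R : ev2 f (cx f) (cy f) = 0 := by
  rw [← AdjoinRoot.eval₂_root f, ev2]
  congr 1
  ext <;> simp
  rfl

lemma ev2_S : ev2 f (sx f) (sy f) = 0 := by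
  rw [← AdjoinRoot.eval₂_root (fS f), ev2, eval₂_map]
  congr 1
  ext <;> simp
  rfl

lemma exists_lift {B : Type*} [CommRing B] [Algebra K B] (ψ : AdjoinRoot f →ₐ[K] B) (ξ η : B)
    (h : ev2 f ξ η = 0) :
    ∃ Ψ : SS f →ₐ[K] B, (∀ r, Ψ (inc f r) = ψ r) ∧ Ψ (sx f) = ξ ∧ Ψ (sy f) = η := by
  have hh : eval₂ (eval₂RingHom (ψ : AdjoinRoot f →+* B) ξ) η (fS f) = 0 := by
    rw [← h, ev2, eval₂_map]
    congr 1
    ext <;> simp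
  have key : ∀ r, AdjoinRoot.lift (eval₂RingHom (ψ : AdjoinRoot f →+* B) ξ) η hh (inc f r) = ψ r := by
    intro r
    have : inc f r = AdjoinRoot.of (fS f) (C r) := rfl
    rw [this, AdjoinRoot.lift_of]
    simp
  refine ⟨{ AdjoinRoot.lift (eval₂RingHom (ψ : AdjoinRoot f →+* B) ξ) η hh with
      commutes' := ?_ }, key, ?_, ?_⟩
  · intro r
    have := key (algebraMap K _ r)
    rw [AlgHom.commutes, AlgHom.commutes] at this
    exact this
  · show AdjoinRoot.lift (eval₂RingHom (ψ : AdjoinRoot f →+* B) ξ) η hh _ = _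
    rw [AdjoinRoot.lift_of]; simp
  · show AdjoinRoot.lift (eval₂RingHom (ψ : AdjoinRoot f →+* B) ξ) η hh _ = _
    rw [AdjoinRoot.lift_root]

lemma monic_fS (hf : IsCurve f d) : (fS f).Monic := hf.monic.map _

lemma smul_S (ξ : AdjoinRoot f) (z : SS f) (a : ℕ) :
    (sx f - inc f ξ) ^ a * z = ((X - C ξ : (AdjoinRoot f)[X]) ^ a) • z := by
  rw [Algebra.smul_def, map_pow, map_sub]
  rfl

lemma dvd_S (hf : IsCurve f d) {ξ ζ : AdjoinRoot f} (hne : ξ ≠ ζ) (a b : ℕ) (z1 z2 : SS f)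
    (h : (sx f - inc f ξ) ^ a * z1 = (sx f - inc f ζ) ^ b * z2) :
    ∃ w, z2 = (sx f - inc f ξ) ^ a * w ∧ z1 = (sx f - inc f ζ) ^ b * w := by
  have hdom : IsDomain (AdjoinRoot f) := AdjoinRoot.isDomain_of_prime hf.irr.prime
  let bs := (AdjoinRoot.powerBasis' (monic_fS hf)).basis
  rw [smul_S, smul_S] at h
  have hd : ∀ i, (X - C ξ : (AdjoinRoot f)[X]) ^ a ∣ bs.repr z2 i := by
    intro i
    have h1 := congrArg (fun z => bs.repr z i) h
    simp only [map_smul, Finsupp.smul_apply, smul_eq_mul] at h1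
    refine (prime_X_sub_C ξ).pow_dvd_of_dvd_mul_left a ?_ (h1 ▸ Dvd.intro _ rfl)
    intro hdv
    have := (prime_X_sub_C ξ).dvd_of_dvd_pow hdv
    rw [dvd_iff_isRoot] at this
    simp [sub_eq_zero] at this
    exact hne this
  choose g hg using hd
  have h2 : z2 = ((X - C ξ : (AdjoinRoot f)[X]) ^ a) • ∑ i, g i • bs i := by
    rw [Finset.smul_sum]
    conv_lhs => rw [← bs.sum_repr z2]
    refine Finset.sum_congr rfl fun i _ => ?_
    rw [hg, smul_smul]
  refine ⟨∑ i, g i • bs i, ?_, ?_⟩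
  · rw [smul_S]; exact h2
  · rw [smul_S]
    rw [h2, smul_comm] at h
    refine bs.ext_elem fun i => ?_
    have h1 := congrArg (fun z => bs.repr z i) h
    simp only [map_smul, Finsupp.smul_apply, smul_eq_mul] at h1
    have := mul_left_cancel₀ (pow_ne_zero a (X_sub_C_ne_zero ξ)) h1
    rw [this, map_smul]; rfl

lemma injective_S (hf : IsCurve f d) (ξ : AdjoinRoot f) (a : ℕ) :
    Function.Injective (LinearMap.mulLeft K ((sx f - inc f ξ) ^ a)) := by
  have hdom : IsDomain (AdjoinRoot f) := AdjoinRoot.isDomain_of_prime hf.irr.prime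
  let bs := (AdjoinRoot.powerBasis' (monic_fS hf)).basis
  intro z1 z2 h
  simp only [LinearMap.mulLeft_apply] at h
  rw [smul_S, smul_S] at h
  refine bs.ext_elem fun i => ?_
  have h1 := congrArg (fun z => bs.repr z i) h
  simp only [map_smul, Finsupp.smul_apply, smul_eq_mul] at h1
  exact mul_left_cancel₀ (pow_ne_zero a (X_sub_C_ne_zero ξ)) h1

end Surf
end LineAvoid

namespace LineAvoid
open Polynomial
section Fil4
variable {K : Type*} [Field K] (f : K[X][X]) {d : ℕ}

/-- weighted filtration on the coordinate ring of the surface -/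
noncomputable def fil4 (w : ℕ) (D : ℤ) : Submodule K (SS f) :=
  Submodule.span K {z | ∃ a b i j : ℕ, (a : ℤ) + b + w * (i + j) ≤ D ∧
    z = inc f (cx f ^ a * cy f ^ b) * (sx f ^ i * sy f ^ j)}

variable {f}

lemma fil4_mono {w : ℕ} {D E : ℤ} (h : D ≤ E) : fil4 f w D ≤ fil4 f w E := by
  apply Submodule.span_mono
  rintro z ⟨a, b, i, j, hab, rfl⟩
  exact ⟨a, b, i, j, hab.trans h, rfl⟩

lemma fil4_mem {w : ℕ} {D : ℤ} (a b i j : ℕ) (h : (a : ℤ) + b + w * (i + j) ≤ D) :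
    inc f (cx f ^ a * cy f ^ b) * (sx f ^ i * sy f ^ j) ∈ fil4 f w D :=
  Submodule.subset_span ⟨a, b, i, j, h, rfl⟩

lemma fil4_mem' {w : ℕ} {D : ℤ} (a b i j : ℕ) (z : SS f) (h : (a : ℤ) + b + w * (i + j) ≤ D)
    (hz : z = inc f (cx f ^ a * cy f ^ b) * (sx f ^ i * sy f ^ j)) : z ∈ fil4 f w D :=
  Submodule.subset_span ⟨a, b, i, j, h, hz⟩

lemma fil4_mul {w : ℕ} {D E : ℤ} {p r : SS f} (hp : p ∈ fil4 f w D) (hr : r ∈ fil4 f w E) :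
    p * r ∈ fil4 f w (D + E) := by
  have h := Submodule.mul_mem_mul hp hr
  rw [fil4, fil4, Submodule.span_mul_span] at h
  refine Submodule.span_mono ?_ h
  rintro _ ⟨_, ⟨a, b, i, j, hab, rfl⟩, _, ⟨a', b', i', j', hab', rfl⟩, rfl⟩
  exact ⟨a + a', b + b', i + i', j + j', by push_cast; linarith, by simp only [map_mul, map_pow]; ring⟩

/-- B element -/
noncomputable def Bw (f : K[X][X]) (w : ℕ) : SS f := bdd f (inc f (cx f ^ w)) (sy f) (inc f (cy f ^ w))
/-- A element -/
noncomputable def Aw (f : K[X][X]) (w : ℕ) : SS f := add1 f (sx f) (inc f (cx f ^ w)) (sy f)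
/-- T element -/
noncomputable def Tw (f : K[X][X]) (w : ℕ) : SS f := sx f - inc f (cx f ^ w)

lemma Bw_mem (hf : IsCurve f d) (w : ℕ) : Bw f w ∈ fil4 f w (w * (d - 1)) := by
  rw [Bw, bdd]
  refine Submodule.sum_mem _ fun j hj => ?_
  rw [aeval_eq_sum_range, Finset.sum_mul]
  refine Submodule.sum_mem _ fun i hi => ?_
  rw [smul_mul_assoc]
  by_cases hij : d < i + j
  · rw [hf.tot i j hij, zero_smul]; exact Submodule.zero_mem _
  refine Submodule.smul_mem _ _ ?_
  rw [Finset.mul_sum]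
  refine Submodule.sum_mem _ fun a ha => ?_
  rw [Finset.mem_range] at ha
  refine fil4_mem' (w * i) (w * (j - 1 - a)) 0 a _ ?_ ?_
  · have : i + (j - 1 - a) + a ≤ d - 1 := by omega
    have h2 : ((i + (j - 1 - a) + a : ℕ) : ℤ) ≤ (d : ℤ) - 1 := by omega
    have h3 := mul_le_mul_of_nonneg_left h2 (Int.natCast_nonneg w)
    push_cast [-Nat.cast_sub] at h3 ⊢
    linarith
  · simp only [map_mul, map_pow]; ring

lemma Aw_mem (hf : IsCurve f d) (w : ℕ) : Aw f w ∈ fil4 f w (w * (d - 1)) := by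
  rw [Aw, add1]
  refine Submodule.sum_mem _ fun j hj => ?_
  rw [Finset.sum_mul]
  refine Submodule.sum_mem _ fun i hi => ?_
  rw [mul_assoc, ← Algebra.smul_def]
  by_cases hij : d < i + j
  · rw [hf.tot i j hij, zero_smul]; exact Submodule.zero_mem _
  refine Submodule.smul_mem _ _ ?_
  rw [Finset.sum_mul]
  refine Submodule.sum_mem _ fun a ha => ?_
  rw [Finset.mem_range] at ha
  refine fil4_mem' (w * (i - 1 - a)) 0 a j _ ?_ ?_
  · have h2 : ((i - 1 - a + a + j : ℕ) : ℤ) ≤ (d : ℤ) - 1 := by omega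
    have h3 := mul_le_mul_of_nonneg_left h2 (Int.natCast_nonneg w)
    push_cast [-Nat.cast_sub] at h3 ⊢
    linarith
  · simp only [map_mul, map_pow]; ring

/-- evaluation along the graph -/
structure IsEv (f : K[X][X]) (w : ℕ) (ε : SS f →ₐ[K] AdjoinRoot f) : Prop where
  hinc : ∀ r, ε (inc f r) = r
  hx : ε (sx f) = cx f ^ w
  hy : ε (sy f) = cy f ^ w

lemma IsEv.T {w : ℕ} {ε : SS f →ₐ[K] AdjoinRoot f} (h : IsEv f w ε) : ε (Tw f w) = 0 := by
  rw [Tw, map_sub, h.hinc, h.hx, sub_self]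

lemma IsEv.root {w : ℕ} {ε : SS f →ₐ[K] AdjoinRoot f} (h : IsEv f w ε) :
    ev2 f (cx f ^ w) (cy f ^ w) = 0 := by
  rw [← h.hx, ← h.hy, ← map_ev2, ev2_S, map_zero]

lemma IsEv.mem {w : ℕ} {ε : SS f →ₐ[K] AdjoinRoot f} (h : IsEv f w ε) {D : ℤ} {u : SS f}
    (hu : u ∈ fil4 f w D) : ε u ∈ fil2 K (cx f) (cy f) D := by
  have : fil4 f w D ≤ (fil2 K (cx f) (cy f) D).comap ε.toLinearMap := by
    rw [fil4, Submodule.span_le]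
    rintro z ⟨a, b, i, j, hab, rfl⟩
    simp only [SetLike.mem_coe, Submodule.mem_comap, AlgHom.toLinearMap_apply]
    rw [map_mul, h.hinc, map_mul, map_pow, map_pow, h.hx, h.hy]
    have := fil2_mem (K := K) (x := cx f) (y := cy f) (D := D) (a + w * i) (b + w * j)
      (by push_cast; linarith)
    convert this using 1
    ring
  exact this hu

lemma gamma0 {w : ℕ} {ε : SS f →ₐ[K] AdjoinRoot f} (h : IsEv f w ε) {D : ℤ} {u : SS f}
    (hu : u ∈ fil4 f w D) : ∃ u1 ∈ fil4 f w (D - w), ∃ u2 ∈ fil4 f w (D - w),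
      u - inc f (ε u) = Tw f w * u1 + (sy f - inc f (cy f ^ w)) * u2 := by
  induction hu using Submodule.span_induction with
  | zero => exact ⟨0, Submodule.zero_mem _, 0, Submodule.zero_mem _, by simp⟩
  | add u v _ _ h1 h2 =>
    obtain ⟨u1, hu1, u2, hu2, hu⟩ := h1
    obtain ⟨v1, hv1, v2, hv2, hv⟩ := h2
    refine ⟨u1 + v1, Submodule.add_mem _ hu1 hv1, u2 + v2, Submodule.add_mem _ hu2 hv2, ?_⟩
    rw [map_add, map_add]
    linear_combination hu + hv
  | smul c u _ h1 =>
    obtain ⟨u1, hu1, u2, hu2, hu⟩ := h1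
    refine ⟨c • u1, Submodule.smul_mem _ _ hu1, c • u2, Submodule.smul_mem _ _ hu2, ?_⟩
    rw [map_smul, map_smul, ← smul_sub, hu, smul_add, mul_smul_comm, mul_smul_comm]
  | mem z hz =>
    obtain ⟨a, b, i, j, hab, rfl⟩ := hz
    refine ⟨inc f (cx f ^ a * cy f ^ b) * sy f ^ j *
        ∑ s ∈ Finset.range i, sx f ^ s * inc f (cx f ^ w) ^ (i - 1 - s), ?_,
      inc f (cx f ^ a * cy f ^ b) * inc f (cx f ^ w) ^ i *
        ∑ s ∈ Finset.range j, sy f ^ s * inc f (cy f ^ w) ^ (j - 1 - s), ?_, ?_⟩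
    · rw [Finset.mul_sum]
      refine Submodule.sum_mem _ fun s hs => ?_
      rw [Finset.mem_range] at hs
      refine fil4_mem' (a + w * (i - 1 - s)) b s j _ ?_ ?_
      · have h2 : ((i - 1 - s : ℕ) : ℤ) = i - 1 - s := by omega
        push_cast [-Nat.cast_sub, h2]
        linarith
      · simp only [map_mul, map_pow]; ring
    · rw [Finset.mul_sum]
      refine Submodule.sum_mem _ fun s hs => ?_
      rw [Finset.mem_range] at hs
      refine fil4_mem' (a + w * i) (b + w * (j - 1 - s)) 0 s _ ?_ ?_
      · have h2 : ((j - 1 - s : ℕ) : ℤ) = j - 1 - s := by omega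
        push_cast [-Nat.cast_sub, h2]
        linarith
      · simp only [map_mul, map_pow]; ring
    · have e0 : ε (inc f (cx f ^ a * cy f ^ b) * (sx f ^ i * sy f ^ j)) =
          (cx f ^ a * cy f ^ b) * ((cx f ^ w) ^ i * (cy f ^ w) ^ j) := by
        rw [map_mul ε, map_mul ε (sx f ^ i), map_pow ε, map_pow ε, h.hx, h.hy, h.hinc]
      have e1 := (Commute.all (sx f) (inc f (cx f ^ w))).geom_sum₂_mul i
      have e2 := (Commute.all (sy f) (inc f (cy f ^ w))).geom_sum₂_mul j
      rw [e0, Tw, map_mul (inc f) (cx f ^ a * cy f ^ b), map_mul (inc f) ((cx f ^ w) ^ i),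
        map_pow (inc f) (cx f ^ w), map_pow (inc f) (cy f ^ w)]
      linear_combination -(inc f (cx f ^ a * cy f ^ b) * sy f ^ j) * e1 -
        inc f (cx f ^ a * cy f ^ b) * inc f (cx f ^ w) ^ i * e2

lemma gamma (hf : IsCurve f d) {w : ℕ} {ε : SS f →ₐ[K] AdjoinRoot f} (h : IsEv f w ε) {D : ℤ}
    {u : SS f} (hu : u ∈ fil4 f w D) (h0 : ε u = 0) :
    ∃ u' ∈ fil4 f w (D + w * (d - 2)), Bw f w * u = Tw f w * u' := by
  obtain ⟨u1, hu1, u2, hu2, hu⟩ := gamma0 h hu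
  rw [h0, map_zero, sub_zero] at hu
  have e1 : Bw f w * (sy f - inc f (cy f ^ w)) = - (Aw f w * Tw f w) := by
    rw [Bw, bdd_mul, Aw, Tw, add1_mul, ev2_S, ← map_ev2, h.root]
    simp
  refine ⟨Bw f w * u1 - Aw f w * u2, Submodule.sub_mem _ ?_ ?_, ?_⟩
  · exact fil4_mono (by linarith) (fil4_mul (Bw_mem hf w) hu1)
  · exact fil4_mono (by linarith) (fil4_mul (Aw_mem hf w) hu2)
  · linear_combination Bw f w * hu + u2 * e1

end Fil4
end LineAvoid

namespace LineAvoid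
open Polynomial

lemma finrank_inf_ker {K V : Type*} [Field K] [AddCommGroup V] [Module K V] [Module.Finite K V]
    (U : Submodule K V) {l : ℕ} (τ : V →ₗ[K] (Fin l → K)) :
    Module.finrank K U ≤ Module.finrank K (U ⊓ LinearMap.ker τ : Submodule K V) + l := by
  have h1 := Submodule.finrank_sup_add_finrank_inf_eq U (LinearMap.ker τ)
  have h2 := τ.finrank_range_add_finrank_ker
  have h3 := Submodule.finrank_le (U ⊔ LinearMap.ker τ)
  have h4 := Submodule.finrank_le (LinearMap.range τ)
  rw [Module.finrank_fin_fun] at h4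
  omega

/-- vanishing order condition -/
def Lv {K : Type*} [Field K] (f : K[X][X]) (d w : ℕ) (M : ℤ) (a : ℕ) (z : SS f) : Prop :=
  ∃ v ∈ fil4 f w (M + a * (w * (d - 2))), Bw f w ^ a * z = Tw f w ^ a * v

section Step
variable {K : Type*} [Field K] {f : K[X][X]} {d : ℕ}

lemma X_pow_dvd_of_unit {a b : PowerSeries K} {n : ℕ} (ha : PowerSeries.constantCoeff a ≠ 0)
    (h : PowerSeries.X ^ n ∣ a * b) : PowerSeries.X ^ n ∣ b := by
  have : IsUnit a := by
    rw [PowerSeries.isUnit_iff_constantCoeff]; exact isUnit_iff_ne_zero.2 ha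
  exact (this.dvd_mul_left).1 h

lemma step (hf : IsCurve f d) {V : Type*} [AddCommGroup V] [Module K V] [Module.Finite K V]
    (s : V →ₗ[K] SS f) (w w' : ℕ) (hww : cx f ^ w ≠ cx f ^ w')
    {ε : SS f →ₐ[K] AdjoinRoot f} (hε : IsEv f w ε) (M M' : ℤ) (a b : ℕ) (U : Submodule K V)
    (hU : ∀ c ∈ U, Lv f d w M a (s c)) (hU' : ∀ c ∈ U, Lv f d w' M' b (s c))
    {ι : Type*} [Fintype ι] [Nonempty ι] (pt : ι → K × K) (hpt : Function.Injective pt)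
    (hp0 : ∀ i, fval f (pt i).1 (pt i).2 = 0)
    (hp1 : ∀ i, fval (derivative f) (pt i).1 (pt i).2 ≠ 0)
    (hpx : ∀ i, (pt i).1 ^ w = (pt i).1) (hpy : ∀ i, (pt i).2 ^ w = (pt i).2)
    (hpx' : ∀ i, (pt i).1 ^ w' = (pt i).1) (hpy' : ∀ i, (pt i).2 ^ w' = (pt i).2)
    (D : ℕ) (hD : (D : ℤ) = M + a * (w * (d - 2))) :
    ∃ U1 ≤ U, (∀ c ∈ U1, Lv f d w M (a + 1) (s c)) ∧
      Module.finrank K U ≤ Module.finrank K U1 + (d * D + 1 - b * Fintype.card ι) := by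
  classical
  choose θ hθ1 hθ2 using fun i => exists_theta hf.monic (pt i).1 (pt i).2 (hp0 i) (hp1 i)
  obtain ⟨g, hg⟩ := LinearMap.exists_leftInverse_of_injective
    (LinearMap.mulLeft K (Tw f w ^ a)) (LinearMap.ker_eq_bot.2 (injective_S hf _ a))
  have hg' : ∀ v, g (Tw f w ^ a * v) = v := fun v => by
    have := congrArg (fun z => z v) hg
    simpa using this
  let lam : V →ₗ[K] AdjoinRoot f := ε.toLinearMap ∘ₗ g ∘ₗ LinearMap.mulLeft K (Bw f w ^ a) ∘ₗ s
  have hlam : ∀ c v, Bw f w ^ a * s c = Tw f w ^ a * v → lam c = ε v := by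
    intro c v hv
    simp only [lam, LinearMap.comp_apply, LinearMap.mulLeft_apply, AlgHom.toLinearMap_apply]
    rw [hv, hg']
  have hvan : ∀ c ∈ U, ∀ i, PowerSeries.X ^ b ∣ θ i (lam c) := by
    intro c hc i
    obtain ⟨v, hv, hv2⟩ := hU c hc
    obtain ⟨v', hv', hv2'⟩ := hU' c hc
    rw [hlam c v hv2]
    obtain ⟨w0, -, hw0⟩ := dvd_S hf hww a b (Bw f w' ^ b * v) (Bw f w ^ a * v') (by
      change Tw f w ^ a * _ = Tw f w' ^ b * _
      linear_combination Bw f w ^ a * hv2' - Bw f w' ^ b * hv2)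
    have h1 := congrArg (fun z => θ i (ε z)) hw0
    simp only [map_mul, map_pow, map_sub, hε.hx, hε.hinc] at h1
    refine X_pow_dvd_of_unit (a := θ i (ε (Bw f w')) ^ b) ?_ ?_
    · rw [map_pow]
      refine pow_ne_zero _ ?_
      have hco : ∀ z, PowerSeries.constantCoeff (θ i z) =
          ((PowerSeries.constantCoeff (R := K)) : PowerSeries K →+* K) (θ i z) := fun z => rfl
      let cc : PowerSeries K →ₐ[K] K := { (PowerSeries.constantCoeff (R := K)) with
        commutes' := fun r => by
          change PowerSeries.constantCoeff (PowerSeries.C r) = r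
          simp }
      have : PowerSeries.constantCoeff (θ i (ε (Bw f w'))) = cc (θ i (ε (Bw f w'))) := rfl
      rw [this, Bw, map_bdd, map_bdd, map_bdd, hε.hinc, hε.hinc, hε.hy]
      have e1 : cc (θ i (cx f)) = (pt i).1 := by
        change PowerSeries.constantCoeff (θ i (cx f)) = _
        rw [hθ1]; simp
      have e2 : cc (θ i (cy f)) = (pt i).2 := hθ2 i
      simp only [map_pow]
      rw [e1, e2, hpx', hpy, hpy', bdd_diag, ev2_K]
      exact hp1 i
    · rw [h1]
      refine Dvd.dvd.mul_right (pow_dvd_pow_of_dvd ?_ b) _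
      rw [PowerSeries.X_dvd_iff, map_sub, hθ1]
      simp [hpx, hpx']
  let l := d * D + 1 - b * Fintype.card ι
  let i0 : ι := Classical.arbitrary ι
  let τ : V →ₗ[K] (Fin l → K) := LinearMap.pi fun k =>
    (PowerSeries.coeff (R := K) (b + (k : ℕ))) ∘ₗ (θ i0).toLinearMap ∘ₗ lam
  refine ⟨U ⊓ LinearMap.ker τ, inf_le_left, ?_, finrank_inf_ker U τ⟩
  rintro c ⟨hc, hc2⟩
  have hX : PowerSeries.X ^ (b + l) ∣ θ i0 (lam c) := by
    rw [PowerSeries.X_pow_dvd_iff]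
    intro m hm
    by_cases hmb : m < b
    · exact PowerSeries.X_pow_dvd_iff.1 (hvan c hc i0) m hmb
    · have := congrFun (LinearMap.mem_ker.1 hc2) ⟨m - b, by omega⟩
      simp only [τ, LinearMap.pi_apply, LinearMap.comp_apply, AlgHom.toLinearMap_apply,
        Pi.zero_apply] at this
      rwa [Nat.add_sub_cancel' (by omega)] at this
  obtain ⟨v, hv, hv2⟩ := hU c hc
  have hz : lam c = 0 := by
    by_contra hne
    have := bezout_smooth hf D (lam c) hne (by rw [hlam c v hv2, hD]; exact hε.mem hv) pt hpt θ
      (fun i => b + if i = i0 then l else 0) hθ1 hθ2 (by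
        intro i
        by_cases h : i = i0
        · subst h; simpa using hX
        · simpa [h] using hvan c hc i)
    rw [Finset.sum_add_distrib] at this
    simp at this
    have h2 : l ≥ d * D + 1 - b * Fintype.card ι := le_rfl
    rw [mul_comm] at this
    omega
  rw [hlam c v hv2] at hz
  obtain ⟨v1, hv1, hv3⟩ := gamma hf hε hv hz
  refine ⟨v1, fil4_mono (by push_cast; linarith) hv1, ?_⟩
  linear_combination Bw f w * hv2 + Tw f w ^ a * hv3

end Step
end LineAvoid

namespace LineAvoid
open Polynomial
section Fin
variable {K : Type*} [Field K] {f : K[X][X]} {d : ℕ}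

lemma IsCurve.d_pos (hf : IsCurve f d) : 1 ≤ d := by
  by_contra h
  have h0 : d = 0 := by omega
  have := hf.monic.natDegree_eq_zero.1 (hf.deg.trans h0)
  exact hf.irr.not_isUnit (this ▸ isUnit_one)

/-- constant coefficient as algebra homomorphism -/
noncomputable def ccAlg (K : Type*) [Field K] : PowerSeries K →ₐ[K] K :=
  { (PowerSeries.constantCoeff (R := K)) with
    commutes' := fun r => by
          change PowerSeries.constantCoeff (PowerSeries.C r) = r
          simp }

lemma ccAlg_apply (z : PowerSeries K) : ccAlg K z = PowerSeries.constantCoeff z := rfl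

lemma exists_point_ne [IsAlgClosed K] (hf : IsCurve f d) (z : AdjoinRoot f) (hz : z ≠ 0) :
    ∃ x0 y0 : K, ∃ φ : AdjoinRoot f →ₐ[K] K, fval f x0 y0 = 0 ∧ φ (cx f) = x0 ∧ φ (cy f) = y0 ∧
      φ z ≠ 0 := by
  classical
  have hroot : ∀ x0 : K, ∃ y0, fval f x0 y0 = 0 := by
    intro x0
    obtain ⟨y, hy⟩ := IsAlgClosed.exists_root (f.map (evalRingHom x0)) (by
      rw [hf.monic.degree_map, degree_eq_natDegree hf.monic.ne_zero, hf.deg]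
      have := hf.d_pos
      exact_mod_cast (by omega : d ≠ 0))
    exact ⟨y, hy⟩
  choose y hy using hroot
  by_contra hcon
  push Not at hcon
  obtain ⟨D, hD⟩ := exists_mem_fil2 f z
  obtain ⟨S, hS⟩ := Infinite.exists_subset_card_eq K (d * D + 1)
  have := card_zeros_le hf D z hz hD (S.image fun x0 => (x0, y x0)) (by
    intro p hp
    obtain ⟨x0, -, rfl⟩ := Finset.mem_image.1 hp
    obtain ⟨φ, h1, h2⟩ := exists_ev f x0 (y x0) (hy x0)
    exact ⟨φ, h1, h2, hcon x0 (y x0) φ (hy x0) h1 h2⟩)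
  rw [Finset.card_image_of_injective _ (fun a b h => (Prod.ext_iff.1 h).1), hS] at this
  omega

/-- section map -/
noncomputable def sMap (f : K[X][X]) (d l m : ℕ) :
    (red d l → red d m → K) →ₗ[K] SS f where
  toFun c := ∑ p : red d l, inc f (∑ r : red d m, c p r • (cx f ^ r.1.1 * cy f ^ r.1.2)) *
    (sx f ^ p.1.1 * sy f ^ p.1.2)
  map_add' c c' := by
    rw [← Finset.sum_add_distrib]
    refine Finset.sum_congr rfl fun p _ => ?_
    rw [← add_mul, ← map_add, ← Finset.sum_add_distrib]
    simp only [Pi.add_apply, add_smul]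
  map_smul' t c := by
    rw [Finset.smul_sum]
    refine Finset.sum_congr rfl fun p _ => ?_
    simp only [Pi.smul_apply, smul_assoc, ← Finset.smul_sum, map_smul, smul_mul_assoc, RingHom.id_apply]

lemma sMap_mem (d l m w : ℕ) (c : red d l → red d m → K) :
    sMap f d l m c ∈ fil4 f w (m + w * l) := by
  refine Submodule.sum_mem _ fun p _ => ?_
  rw [map_sum, Finset.sum_mul]
  refine Submodule.sum_mem _ fun r _ => ?_
  rw [map_smul, smul_mul_assoc]
  refine Submodule.smul_mem _ _ (fil4_mem _ _ _ _ ?_)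
  have h1 := (mem_red.1 p.2).2
  have h2 := (mem_red.1 r.2).2
  have h3 : ((p.1.1 : ℤ) + p.1.2) ≤ l := by exact_mod_cast h1
  have h4 : ((r.1.1 : ℤ) + r.1.2) ≤ m := by exact_mod_cast h2
  have := mul_le_mul_of_nonneg_left h3 (Int.natCast_nonneg w)
  linarith

lemma red_indep' (hf : IsCurve f d) (D : ℕ) (c : red d D → K)
    (h : ∑ p, c p • ((cx f) ^ p.1.1 * (cy f) ^ p.1.2) = 0) : c = 0 := by
  classical
  have := red_indep hf (red d D) (fun p hp => (mem_red.1 hp).1)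
    (fun p => if h : p ∈ red d D then c ⟨p, h⟩ else 0) (by
      rw [← h, ← Finset.sum_coe_sort]
      simp)
  ext p
  simpa using this p.1 p.2

lemma final_contra [IsAlgClosed K] (hf : IsCurve f d) (l m a : ℕ)
    (c : red d l → red d m → K) (hc : c ≠ 0) (v : SS f)
    (hv : Bw f 1 ^ a * sMap f d l m c = Tw f 1 ^ a * v)
    (hder : ev2 (derivative f) (cx f) (cy f) ≠ 0) : a ≤ d * l := by
  have hdom : IsDomain (AdjoinRoot f) := AdjoinRoot.isDomain_of_prime hf.irr.prime
  obtain ⟨p0, hp0⟩ : ∃ p0, c p0 ≠ 0 := by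
    by_contra h
    push Not at h
    exact hc (funext h)
  set R : red d l → AdjoinRoot f := fun p => ∑ r : red d m, c p r • (cx f ^ r.1.1 * cy f ^ r.1.2) with hR
  have hr0 : R p0 ≠ 0 := fun h => hp0 (red_indep' hf m _ h)
  obtain ⟨x0, y0, φ, h0, hx, hy, hφ⟩ := exists_point_ne hf _ (mul_ne_zero hr0 hder)
  rw [map_mul, map_ev2, hx, hy, ev2_K] at hφ
  have hφ1 := left_ne_zero_of_mul hφ
  have hφ2 := right_ne_zero_of_mul hφ
  obtain ⟨θ, hθ1, hθ2⟩ := exists_theta hf.monic x0 y0 h0 hφ2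
  obtain ⟨Ψ, hΨ, hΨx, hΨy⟩ := exists_lift ((Algebra.ofId K (AdjoinRoot f)).comp φ) (cx f) (cy f) ev2_R
  have hs : Ψ (sMap f d l m c) = ∑ p : red d l, φ (R p) • (cx f ^ p.1.1 * cy f ^ p.1.2) := by
    change Ψ (∑ p : red d l, inc f (R p) * (sx f ^ p.1.1 * sy f ^ p.1.2)) = _
    rw [map_sum]
    refine Finset.sum_congr rfl fun p _ => ?_
    rw [map_mul, hΨ, map_mul, map_pow, map_pow, hΨx, hΨy, Algebra.smul_def]
    rfl
  have hne : Ψ (sMap f d l m c) ≠ 0 := by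
    intro h
    rw [hs] at h
    have := congrFun (red_indep' hf l _ h) p0
    exact hφ1 this
  have hmem : Ψ (sMap f d l m c) ∈ fil2 K (cx f) (cy f) (l : ℤ) := by
    rw [hs]
    refine Submodule.sum_mem _ fun p _ => Submodule.smul_mem _ _ (fil2_mem _ _ ?_)
    have := (mem_red.1 p.2).2
    exact_mod_cast this
  have := bezout_smooth hf l _ hne hmem (ι := Unit) (fun _ => (x0, y0)) (fun _ _ _ => rfl)
    (fun _ => θ) (fun _ => a) (fun _ => hθ1) (fun _ => hθ2) (by
      intro _
      have h1 := congrArg (fun z => θ (Ψ z)) hv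
      simp only [map_mul, map_pow] at h1
      have e1 : ccAlg K (θ (cy f)) = y0 := hθ2
      have e3 : ccAlg K (θ (algebraMap K (AdjoinRoot f) x0)) = x0 := by
        rw [AlgHom.commutes, AlgHom.commutes]; rfl
      have e4 : ccAlg K (θ (algebraMap K (AdjoinRoot f) y0)) = y0 := by
        rw [AlgHom.commutes, AlgHom.commutes]; rfl
      have e5 : ∀ z, ((Algebra.ofId K (AdjoinRoot f)).comp φ) z = algebraMap K _ (φ z) := fun z => rfl
      refine X_pow_dvd_of_unit (a := θ (Ψ (Bw f 1)) ^ a) ?_ ?_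
      · rw [map_pow]
        refine pow_ne_zero _ ?_
        rw [← ccAlg_apply, Bw, map_bdd, map_bdd, map_bdd, hΨ, hΨ, hΨy, e1, pow_one, pow_one, e5, e5,
          hx, hy, e3, e4, bdd_diag, ev2_K]
        exact hφ2
      · rw [h1]
        refine Dvd.dvd.mul_right (pow_dvd_pow_of_dvd ?_ a) _
        rw [PowerSeries.X_dvd_iff, Tw, map_sub, map_sub, hΨx, hΨ, pow_one, e5, hx, map_sub,
          ← ccAlg_apply, ← ccAlg_apply, e3, ccAlg_apply, hθ1]
        simp)
  simpa using this

end Fin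
end LineAvoid

namespace LineAvoid
open Polynomial
lemma sum_trunc (E : ℕ) (n : ℕ) (x : ℤ) :
    2 * (E : ℤ) * ∑ i ∈ Finset.range n, ((x - i * E).toNat : ℤ) ≤ (max (x + E) 0) ^ 2 := by
  induction n generalizing x with
  | zero => simp
  | succ n ih =>
    rw [Finset.sum_range_succ']
    have h1 := ih (x - E)
    have h2 : ∑ i ∈ Finset.range n, ((x - ((i + 1 : ℕ) : ℤ) * E).toNat : ℤ) =
        ∑ i ∈ Finset.range n, ((x - E - i * E).toNat : ℤ) := by
      refine Finset.sum_congr rfl fun i _ => ?_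
      congr 2
      push_cast; ring
    rw [h2, mul_add]
    simp only [Nat.cast_zero, zero_mul, sub_zero]
    rw [sub_add_cancel] at h1
    rcases le_or_gt x 0 with hx | hx
    · rw [max_eq_right hx] at h1
      rw [Int.toNat_of_nonpos hx]
      have : 0 ≤ (max (x + E) 0) ^ 2 := by positivity
      push_cast; linarith
    · rw [max_eq_left hx.le] at h1
      rw [Int.toNat_of_nonneg hx.le, max_eq_left (by positivity)]
      nlinarith [sq_nonneg (E : ℤ)]

lemma numeric_contra (d r e E Z l m S k1 k2 : ℕ) (x : ℤ) (hd : 1 ≤ d) (hr : 1 ≤ r)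
    (hEr : (r + 1) ^ 2 + 1 ≤ E) (hZ : Z = r * (d * e) + 1 + E)
    (hl : l = 2 * r * (r + 1) * Z + E * d ^ 2 * (1 + r) + r * Z ^ 2 + 1 + d ^ 2) (hm : m = r * l)
    (hx : x = (r + 1) * (d * l) + r * (d * e) + 1) (hS' : 2 * (E : ℤ) * S ≤ (x + E) ^ 2)
    (c1 : (d : ℤ) * l - d * d ≤ k1) (c2 : (d : ℤ) * m - d * d ≤ k2) (h3 : k1 * k2 ≤ 2 * r * S) :
    False := by
  have h3' : (k1 : ℤ) * k2 ≤ 2 * r * S := by exact_mod_cast h3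
  have hdl : (d : ℤ) ^ 2 ≤ l := by
    have : d ^ 2 ≤ l := by rw [hl]; omega
    exact_mod_cast this
  have hd1 : (1 : ℤ) ≤ d := by exact_mod_cast hd
  have hr1' : (1 : ℤ) ≤ r := by exact_mod_cast hr
  have hlnn : (0 : ℤ) ≤ l := by positivity
  obtain ⟨y, hy⟩ : ∃ y : ℤ, y = d * l := ⟨_, rfl⟩
  have hyl : (l : ℤ) ≤ y := by rw [hy]; exact le_mul_of_one_le_left hlnn hd1
  have hm' : (d : ℤ) * m = r * y := by rw [hm, hy]; push_cast; ring
  have hyd : (d : ℤ) ^ 2 ≤ y := hdl.trans hyl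
  have hy0 : 0 ≤ y := hlnn.trans hyl
  have hry : y ≤ r * y := le_mul_of_one_le_left hy0 hr1'
  have hc : (y - d ^ 2) * (r * y - d ^ 2) ≤ (k1 : ℤ) * k2 := by
    apply mul_le_mul
    · rw [hy]; linarith [sq (d : ℤ)]
    · linarith [sq (d : ℤ)]
    · linarith
    · positivity
  have hxE : x + E = (r + 1) * y + Z := by rw [hx, hZ, hy]; push_cast; ring
  have hE0 : (0 : ℤ) ≤ E := by positivity
  have hEr' : ((r : ℤ) + 1) ^ 2 + 1 ≤ E := by exact_mod_cast hEr
  have k1 : (E : ℤ) * ((y - d ^ 2) * (r * y - d ^ 2)) ≤ r * ((r + 1) * y + Z) ^ 2 := by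
    calc (E : ℤ) * ((y - d ^ 2) * (r * y - d ^ 2)) ≤ E * (2 * r * S) :=
          mul_le_mul_of_nonneg_left (hc.trans h3') hE0
      _ = r * (2 * E * S) := by ring
      _ ≤ r * (x + E) ^ 2 := mul_le_mul_of_nonneg_left hS' (by positivity)
      _ = _ := by rw [hxE]
  have hl' : (l : ℤ) = 2 * r * (r + 1) * Z + E * d ^ 2 * (1 + r) + r * Z ^ 2 + 1 + d ^ 2 := by
    rw [hl]; push_cast; ring
  have hl1 : (1 : ℤ) ≤ l := by
    have : 1 ≤ l := by rw [hl]; omega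
    exact_mod_cast this
  have hy1 : 1 ≤ y := hl1.trans hyl
  have k2 : (r : ℤ) * y ^ 2 ≤ (2 * r * (r + 1) * Z + E * d ^ 2 * (1 + r)) * y + r * Z ^ 2 := by
    have k3 := mul_le_mul_of_nonneg_left hEr' (show (0 : ℤ) ≤ r * y ^ 2 by positivity)
    have k4 : (0 : ℤ) ≤ E * d ^ 4 := by positivity
    linarith
  have k5 : (r : ℤ) * Z ^ 2 ≤ r * Z ^ 2 * y := le_mul_of_one_le_right (by positivity) hy1
  have k6 : y * l ≤ r * y ^ 2 := by
    calc y * l ≤ y * y := mul_le_mul_of_nonneg_left hyl (by linarith)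
      _ = 1 * y ^ 2 := by ring
      _ ≤ r * y ^ 2 := mul_le_mul_of_nonneg_right hr1' (by positivity)
  rw [hl'] at k6
  have k7 : 0 ≤ (d : ℤ) ^ 2 * y := by positivity
  linarith

section Weil
variable {K : Type*} [Field K] [IsAlgClosed K] {f : K[X][X]} {d : ℕ}

theorem weil_upper (hf : IsCurve f d) (hd : 2 ≤ d) (q r : ℕ) (hq : 2 ≤ q) (hr : q ≤ r ^ 2)
    (hfq : ev2 f (cx f ^ q) (cy f ^ q) = 0)
    {ι : Type*} [Fintype ι] (pt : ι → K × K) (hpt : Function.Injective pt)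
    (hp0 : ∀ i, fval f (pt i).1 (pt i).2 = 0)
    (hp1 : ∀ i, fval (derivative f) (pt i).1 (pt i).2 ≠ 0)
    (hpx : ∀ i, (pt i).1 ^ q = (pt i).1) (hpy : ∀ i, (pt i).2 ^ q = (pt i).2) :
    Fintype.card ι ≤ (r + 1) ^ 2 + r * (d * (d - 2)) := by
  by_contra hcon
  push Not at hcon
  have hne : Nonempty ι := by
    rw [← Fintype.card_pos_iff]; omega
  have hr1 : 1 ≤ r := by
    by_contra h
    have : r = 0 := by omega
    subst this; simp at hr; omega
  obtain ⟨e, hde⟩ : ∃ e, d = e + 2 := ⟨d - 2, by omega⟩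
  have hde' : d - 2 = e := by omega
  rw [hde'] at hcon
  obtain ⟨N, hN⟩ : ∃ N, N = Fintype.card ι := ⟨_, rfl⟩
  rw [← hN] at hcon
  obtain ⟨E, hE⟩ : ∃ E, N = E + r * (d * e) := ⟨N - r * (d * e), by omega⟩
  have hEr : (r + 1) ^ 2 + 1 ≤ E := by omega
  obtain ⟨ε, hε1, hε2, hε3⟩ := exists_lift (AlgHom.id K (AdjoinRoot f)) (cx f ^ q) (cy f ^ q) hfq
  have hε : IsEv f q ε := ⟨hε1, hε2, hε3⟩
  obtain ⟨ε', hε1', hε2', hε3'⟩ := exists_lift (AlgHom.id K (AdjoinRoot f)) (cx f ^ 1) (cy f ^ 1)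
    (by rw [pow_one, pow_one]; exact ev2_R)
  have hε' : IsEv f 1 ε' := ⟨hε1', hε2', hε3'⟩
  have hxx : cx f ^ 1 ≠ cx f ^ q := by
    intro h
    have := red_indep hf {(1, 0), (q, 0)} (by simp; omega) (fun p => if p.1 = 1 then 1 else -1) (by
      rw [Finset.sum_pair (by simp; omega)]
      simp [← h, show q ≠ 1 by omega]) (1, 0) (by simp)
    simp at this
  obtain ⟨Z, hZ⟩ : ∃ Z, Z = r * (d * e) + 1 + E := ⟨_, rfl⟩
  obtain ⟨l, hl⟩ : ∃ l, l = 2 * r * (r + 1) * Z + E * d ^ 2 * (1 + r) + r * Z ^ 2 + 1 + d ^ 2 := ⟨_, rfl⟩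
  obtain ⟨m, hm⟩ : ∃ m, m = r * l := ⟨_, rfl⟩
  obtain ⟨s, hs⟩ : ∃ s, s = sMap f d l m := ⟨_, rfl⟩
  let Good : ℕ → ℕ → ℕ → Prop := fun a b L => ∃ U : Submodule K (red d l → red d m → K),
    (∀ c ∈ U, Lv f d 1 (m + (1 : ℕ) * l) a (s c)) ∧ (∀ c ∈ U, Lv f d q (m + q * l) b (s c)) ∧
    Module.finrank K (red d l → red d m → K) ≤ Module.finrank K U + L
  have gmono : ∀ a b L L', L ≤ L' → Good a b L → Good a b L' := by
    rintro a b L L' h ⟨U, h1, h2, h3⟩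
    exact ⟨U, h1, h2, by omega⟩
  have g0 : Good 0 0 0 := by
    refine ⟨⊤, fun c _ => ⟨s c, ?_, by simp⟩, fun c _ => ⟨s c, ?_, by simp⟩, by simp⟩
    · simpa [hs] using sMap_mem (f := f) d l m 1 c
    · simpa [hs] using sMap_mem (f := f) d l m q c
  have gD : ∀ a b L, Good a b L → Good (a + 1) b (L + (d * (m + l + a * e) + 1 - b * N)) := by
    rintro a b L ⟨U, h1, h2, h3⟩
    obtain ⟨U1, hle, h4, h5⟩ := step hf s 1 q hxx hε' _ _ a b U h1 h2 pt hpt hp0 hp1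
      (by simp) (by simp) hpx hpy (m + l + a * e) (by simp [hde])
    rw [← hN] at h5
    exact ⟨U1, h4, fun c hc => h2 c (hle hc), by omega⟩
  have gG : ∀ a b L, Good a b L →
      Good a (b + 1) (L + (d * (m + q * l + b * (q * e)) + 1 - a * N)) := by
    rintro a b L ⟨U, h1, h2, h3⟩
    obtain ⟨U1, hle, h4, h5⟩ := step hf s q 1 hxx.symm hε _ _ b a U h2 h1 pt hpt hp0 hp1
      hpx hpy (by simp) (by simp) (m + q * l + b * (q * e)) (by simp [hde])
    rw [← hN] at h5
    exact ⟨U1, fun c hc => h1 c (hle hc), h4, by omega⟩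
  obtain ⟨x, hx⟩ : ∃ x : ℤ, x = (r + 1) * (d * l) + r * (d * e) + 1 := ⟨_, rfl⟩
  have hNE : (N : ℤ) = E + r * (d * e) := by exact_mod_cast hE
  have blockD : ∀ i j L, j ≤ r → Good (r * i) i L →
      Good (r * i + j) i (L + j * (x - i * E).toNat) := by
    intro i j L hj h
    induction j with
    | zero => simpa using h
    | succ j ih =>
      have hg := gD (r * i + j) i _ (ih (by omega))
      refine gmono (r * i + j + 1) i _ _ ?_ hg
      have hje : (j : ℤ) * (d * e) ≤ r * (d * e) :=
        mul_le_mul_of_nonneg_right (by exact_mod_cast (by omega)) (by positivity)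
      have : d * (m + l + (r * i + j) * e) + 1 - i * N ≤ (x - i * E).toNat := by
        rw [Nat.sub_le_iff_le_add]
        zify
        have := Int.self_le_toNat (x - i * E)
        have e1 : (m : ℤ) = r * l := by simp [hm]
        rw [e1, hNE]
        nlinarith
      have e3 : (j + 1) * (x - i * E).toNat = j * (x - i * E).toNat + (x - i * E).toNat := by ring
      omega
  have block : ∀ i L, Good (r * i) i L → Good (r * (i + 1)) (i + 1) (L + 2 * r * (x - i * E).toNat) := by
    intro i L h
    have h1 := blockD i r L le_rfl h
    have h2 := gG _ _ _ h1
    rw [show r * i + r = r * (i + 1) by ring] at h2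
    refine gmono _ _ _ _ ?_ h2
    have : d * (m + q * l + i * (q * e)) + 1 - r * (i + 1) * N ≤ r * (x - i * E).toNat := by
      rw [Nat.sub_le_iff_le_add]
      zify
      have h3 := mul_le_mul_of_nonneg_left (Int.self_le_toNat (x - i * E)) (Int.natCast_nonneg r)
      have e1 : (m : ℤ) = r * l := by simp [hm]
      have hq1 : (q : ℤ) * (d * l + i * (d * e)) ≤ r ^ 2 * (d * l + i * (d * e)) :=
        mul_le_mul_of_nonneg_right (by exact_mod_cast hr) (by positivity)
      have hr1' : (1 : ℤ) ≤ r := by exact_mod_cast hr1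
      have hE0 : (0 : ℤ) ≤ r * E := by positivity
      have hrr : (0 : ℤ) ≤ r * (r * (d * e)) := by positivity
      rw [e1, hNE]
      rw [hx] at h3 ⊢
      nlinarith
    rw [show 2 * r * (x - i * E).toNat = r * (x - i * E).toNat + r * (x - i * E).toNat by ring]
    omega
  have all : ∀ n, Good (r * n) n (2 * r * ∑ i ∈ Finset.range n, (x - i * E).toNat) := by
    intro n
    induction n with
    | zero => simpa using g0
    | succ n ih =>
      rw [Finset.sum_range_succ, Nat.mul_add (2 * r)]
      exact block n _ ih
  obtain ⟨U, h1, -, h3⟩ := all (d * l + 1)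
  obtain ⟨S, hS⟩ : ∃ S, S = ∑ i ∈ Finset.range (d * l + 1), (x - i * E).toNat := ⟨_, rfl⟩
  rw [← hS] at h3
  have hpos : 0 < Module.finrank K U := by
    by_contra h0
    have h0' : Module.finrank K U = 0 := by omega
    rw [h0', zero_add] at h3
    simp only [Module.finrank_pi_fintype, Module.finrank_self, Finset.sum_const, Finset.card_univ,
      Fintype.card_coe, smul_eq_mul, mul_one] at h3
    have hb := sum_trunc E (d * l + 1) x
    rw [max_eq_left (by rw [hx]; positivity)] at hb
    exact numeric_contra d r e E Z l m S (red d l).card (red d m).card x (by omega) hr1 hEr hZ hl hm hx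
      (by rw [hS]; push_cast; exact hb) (card_red_lower d l) (card_red_lower d m) h3
  obtain ⟨⟨c, hcU⟩, hc0⟩ := (Module.finrank_pos_iff_exists_ne_zero (R := K)).1 hpos
  obtain ⟨v, -, hv⟩ := h1 c hcU
  have := final_contra hf l m _ c (by simpa using hc0) v (hs ▸ hv) (by
    intro h
    obtain ⟨i⟩ := hne
    obtain ⟨φ, e1, e2⟩ := exists_ev f _ _ (hp0 i)
    have := congrArg φ h
    rw [map_ev2, e1, e2, map_zero, ev2_K] at this
    exact hp1 i this)
  have : 1 * (d * l + 1) ≤ r * (d * l + 1) := Nat.mul_le_mul_right _ hr1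
  omega

end Weil
end LineAvoid

namespace LineAvoid
open Polynomial
section Count

lemma mk_eq_ev2 {K : Type*} [Field K] (f p : K[X][X]) : AdjoinRoot.mk f p = ev2 p (cx f) (cy f) := by
  rw [ev2]
  conv_lhs => rw [← AdjoinRoot.aeval_eq, aeval_def]
  congr 1
  ext <;> simp
  rfl

lemma fil2_of_tot {K : Type*} [Field K] {f : K[X][X]} (p : K[X][X]) (D : ℕ)
    (h : ∀ i j, D < i + j → (p.coeff j).coeff i = 0) :
    ev2 p (cx f) (cy f) ∈ fil2 K (cx f) (cy f) D := by
  rw [ev2_eq]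
  refine Submodule.sum_mem _ fun j _ => ?_
  rw [aeval_eq_sum_range, Finset.sum_mul]
  refine Submodule.sum_mem _ fun i _ => ?_
  rw [smul_mul_assoc]
  by_cases hij : D < i + j
  · rw [h i j hij, zero_smul]; exact Submodule.zero_mem _
  · exact Submodule.smul_mem _ _ (fil2_mem _ _ (by omega))

lemma ev2_map {k K A : Type*} [Field k] [Field K] [Algebra k K] [CommRing A] [Algebra K A]
    [Algebra k A] [IsScalarTower k K A] (g : k[X][X]) (ξ η : A) :
    ev2 (g.map (mapRingHom (algebraMap k K))) ξ η = ev2 g ξ η := by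
  rw [ev2, ev2, eval₂_map]
  congr 1
  ext
  · simp [← IsScalarTower.algebraMap_apply]
  · simp

variable {k K : Type*} [Field k] [Fintype k] [Field K] [IsAlgClosed K] [Algebra k K] {d : ℕ}

theorem card_points_le (g : k[X][X]) (hf : IsCurve (g.map (mapRingHom (algebraMap k K))) d)
    (hd : 2 ≤ d) (hder : derivative (g.map (mapRingHom (algebraMap k K))) ≠ 0) (r : ℕ)
    (hr : Fintype.card k ≤ r ^ 2) (S : Finset (k × k)) (hS : ∀ p ∈ S, fval g p.1 p.2 = 0) :
    S.card ≤ (r + 1) ^ 2 + r * (d * (d - 2)) + d * (d - 1) := by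
  classical
  set f := g.map (mapRingHom (algebraMap k K)) with hfg
  let e : k × k → K × K := fun p => (algebraMap k K p.1, algebraMap k K p.2)
  have he : Function.Injective e := by
    intro a b h
    have h1 := Prod.ext_iff.1 h
    exact Prod.ext ((algebraMap k K).injective h1.1) ((algebraMap k K).injective h1.2)
  have hS' : ∀ p ∈ S, fval f (e p).1 (e p).2 = 0 := by
    intro p hp
    have h := hS p hp
    rw [← ev2_K] at h
    rw [← ev2_K, hfg, ev2_map]
    have := map_ev2 (Algebra.ofId k K) g p.1 p.2
    rw [h, map_zero] at this
    exact this.symm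
  have hfq : ev2 f (cx f ^ Fintype.card k) (cy f ^ Fintype.card k) = 0 := by
    have hm : ∀ ξ η : AdjoinRoot f, ev2 f ξ η = ev2 g ξ η := fun ξ η => ev2_map g ξ η
    have h := ev2_R (f := f)
    rw [hm] at h ⊢
    have := map_ev2 (FiniteField.frobeniusAlgHom k (AdjoinRoot f)) g (cx f) (cy f)
    rw [h, map_zero] at this
    exact this.symm
  let p0 : k × k → Prop := fun p => fval (derivative f) (e p).1 (e p).2 ≠ 0
  have h1 : (S.filter p0).card ≤ (r + 1) ^ 2 + r * (d * (d - 2)) := by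
    have := weil_upper hf hd (Fintype.card k) r Fintype.one_lt_card hr hfq
      (ι := S.filter p0) (fun p => e p.1) (fun a b h => Subtype.ext (he h))
      (fun p => hS' _ (Finset.mem_filter.1 p.2).1) (fun p => (Finset.mem_filter.1 p.2).2)
      (fun p => by simp only [e]; rw [← map_pow, FiniteField.pow_card])
      (fun p => by simp only [e]; rw [← map_pow, FiniteField.pow_card])
    rwa [Fintype.card_coe] at this
  have h2 : (S.filter fun p => ¬ p0 p).card ≤ d * (d - 1) := by
    have hc0 : ev2 (derivative f) (cx f) (cy f) ≠ 0 := by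
      rw [← mk_eq_ev2, Ne, AdjoinRoot.mk_eq_zero]
      intro h
      have h3 := natDegree_le_of_dvd h hder
      have h4 := natDegree_derivative_lt (p := f) (by rw [hf.deg]; omega)
      omega
    have := card_zeros_le hf (d - 1) _ hc0 (fil2_of_tot _ _ (by
        intro i j hij
        rw [coeff_derivative, show ((j : K[X]) + 1) = C ((j : K) + 1) by simp, coeff_mul_C,
          hf.tot i (j + 1) (by omega), zero_mul]))
      ((S.filter fun p => ¬ p0 p).image e) (by
        intro P hP
        obtain ⟨p, hp, rfl⟩ := Finset.mem_image.1 hP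
        obtain ⟨hp1, hp2⟩ := Finset.mem_filter.1 hp
        obtain ⟨φ, e1, e2⟩ := exists_ev f _ _ (hS' p hp1)
        refine ⟨φ, e1, e2, ?_⟩
        rw [map_ev2, e1, e2, ev2_K]
        exact not_not.1 hp2)
    rwa [Finset.card_image_of_injective _ he] at this
  have := Finset.card_filter_add_card_filter_not (s := S) p0
  omega

end Count
end LineAvoid

namespace LineAvoid
open Polynomial
section Comb
variable {k : Type*} [Field k] [Fintype k] [DecidableEq k]

lemma comb_lines (Z : Finset (k × k)) (d : ℕ) (Bad : Finset k) (hBad : Bad.card ≤ d)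
    (hdq : d < Fintype.card k)
    (hv : ∀ x0, (Z.filter fun p => p.1 = x0).card ≤ d)
    (hl : ∀ α β, (Z.filter fun p => p.2 - α * p.1 = β).card ≤ d)
    (hex : ∀ α ∉ Bad, ∀ β, ∃ p ∈ Z, p.2 - α * p.1 = β) :
    Fintype.card k ≤ Z.card ∧
    (Z.card : ℤ) * (Z.card - 1) ≤ Z.card * (d ^ 2 - 1) + Fintype.card k * (d * (Z.card - Fintype.card k)) := by
  classical
  set q := Fintype.card k with hq
  let L : k → k → ℕ := fun α β => (Z.filter fun p => p.2 - α * p.1 = β).card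
  have hsum : ∀ α, ∑ β, L α β = Z.card := fun α =>
    (Finset.card_eq_sum_card_fiberwise (f := fun p : k × k => p.2 - α * p.1) (t := Finset.univ)
      (fun p _ => Finset.mem_coe.2 (Finset.mem_univ _))).symm
  have hpos : ∀ α ∉ Bad, ∀ β, 1 ≤ L α β := by
    intro α hα β
    obtain ⟨p, hp, h⟩ := hex α hα β
    exact Finset.card_pos.2 ⟨p, Finset.mem_filter.2 ⟨hp, h⟩⟩
  have hqN : q ≤ Z.card := by
    obtain ⟨α, hα⟩ : ∃ α, α ∉ Bad := by
      by_contra h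
      push Not at h
      have : Bad = Finset.univ := Finset.eq_univ_iff_forall.2 h
      rw [this, Finset.card_univ] at hBad
      omega
    rw [← hsum α]
    calc q = ∑ β : k, 1 := by simp [hq]
      _ ≤ _ := Finset.sum_le_sum fun β _ => hpos α hα β
  refine ⟨hqN, ?_⟩
  -- pairs through a point
  have hpt : ∀ p ∈ Z, (Z.card : ℤ) - 1 ≤ (d ^ 2 - 1) +
      ∑ α ∈ Badᶜ, ((L α (p.2 - α * p.1) : ℤ) - 1) := by
    intro p hp
    have hcov : Z.erase p ⊆ ((Z.filter fun p' => p'.1 = p.1).erase p) ∪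
        Finset.univ.biUnion (fun α => (Z.filter fun p' => p'.2 - α * p'.1 = p.2 - α * p.1).erase p) := by
      intro p' hp'
      rw [Finset.mem_erase] at hp'
      rw [Finset.mem_union]
      by_cases h : p'.1 = p.1
      · left; simp [hp', h]
      · right
        rw [Finset.mem_biUnion]
        refine ⟨(p'.2 - p.2) / (p'.1 - p.1), Finset.mem_univ _, ?_⟩
        simp only [Finset.mem_erase, Finset.mem_filter]
        refine ⟨hp'.1, hp'.2, ?_⟩
        have : p'.1 - p.1 ≠ 0 := sub_ne_zero.2 h
        field_simp
        ring
    have h1 := (Finset.card_le_card hcov).trans (Finset.card_union_le _ _)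
    have h2 := h1.trans (Nat.add_le_add_left Finset.card_biUnion_le _)
    rw [Finset.card_erase_of_mem hp, Finset.card_erase_of_mem (by simp [hp])] at h2
    have h3 : ∀ α, ((Z.filter fun p' => p'.2 - α * p'.1 = p.2 - α * p.1).erase p).card =
        L α (p.2 - α * p.1) - 1 := fun α => Finset.card_erase_of_mem (by simp [hp])
    simp only [h3] at h2
    have h4 : ∀ α, 1 ≤ L α (p.2 - α * p.1) := fun α => Finset.card_pos.2 ⟨p, by simp [hp]⟩
    have h5 : 1 ≤ (Z.filter fun p' => p'.1 = p.1).card := Finset.card_pos.2 ⟨p, by simp [hp]⟩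
    have h6 := hv p.1
    rw [← Finset.sum_add_sum_compl Bad] at h2
    have h7 : ∑ α ∈ Bad, (L α (p.2 - α * p.1) - 1) ≤ d * (d - 1) := by
      calc _ ≤ ∑ α ∈ Bad, (d - 1) := Finset.sum_le_sum fun α _ => Nat.sub_le_sub_right (hl α _) 1
        _ = Bad.card * (d - 1) := by simp
        _ ≤ _ := Nat.mul_le_mul_right _ hBad
    have h8 : ((∑ α ∈ Badᶜ, (L α (p.2 - α * p.1) - 1) : ℕ) : ℤ) =
        ∑ α ∈ Badᶜ, ((L α (p.2 - α * p.1) : ℤ) - 1) := by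
      push_cast
      exact Finset.sum_congr rfl fun α _ => by rw [Nat.cast_sub (h4 α)]; rfl
    have hd1 : 1 ≤ d := h5.trans h6
    have hZ1 : 1 ≤ Z.card := Finset.card_pos.2 ⟨p, hp⟩
    rw [← h8]
    have h9 : Z.card - 1 ≤ (d - 1) + (d * (d - 1) + ∑ α ∈ Badᶜ, (L α (p.2 - α * p.1) - 1)) := by
      omega
    have h10 : ((Z.card - 1 : ℕ) : ℤ) ≤ ((d - 1 : ℕ) : ℤ) + ((d : ℤ) * ((d - 1 : ℕ) : ℤ) +
        ((∑ α ∈ Badᶜ, (L α (p.2 - α * p.1) - 1) : ℕ) : ℤ)) := by exact_mod_cast h9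
    rw [Nat.cast_sub hd1, Nat.cast_sub hZ1] at h10
    rw [Nat.cast_one] at h10
    linarith
  have hgood : ∀ α ∈ Badᶜ, ∑ p ∈ Z, ((L α (p.2 - α * p.1) : ℤ) - 1) ≤ d * (Z.card - q) := by
    intro α hα
    have h1 : ∑ p ∈ Z, ((L α (p.2 - α * p.1) : ℤ) - 1) = ∑ β, (L α β : ℤ) * ((L α β : ℤ) - 1) := by
      rw [← Finset.sum_fiberwise_of_maps_to (s := Z) (t := Finset.univ)
        (g := fun p : k × k => p.2 - α * p.1) (fun p _ => Finset.mem_univ _)]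
      refine Finset.sum_congr rfl fun β _ => ?_
      rw [Finset.sum_congr rfl (g := fun _ => (L α β : ℤ) - 1)]
      · rw [Finset.sum_const, nsmul_eq_mul]
      · intro p hp
        rw [(Finset.mem_filter.1 hp).2]
    rw [h1]
    calc ∑ β, (L α β : ℤ) * ((L α β : ℤ) - 1) ≤ ∑ β, (d : ℤ) * ((L α β : ℤ) - 1) := by
          refine Finset.sum_le_sum fun β _ => mul_le_mul_of_nonneg_right ?_ ?_
          · exact_mod_cast hl α β
          · have := hpos α (Finset.mem_compl.1 hα) β
            have : (1 : ℤ) ≤ L α β := by exact_mod_cast this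
            linarith
      _ = d * (Z.card - q) := by
          rw [← Finset.mul_sum, Finset.sum_sub_distrib, ← hsum α]
          push_cast
          simp [hq]
  have h0 : 0 ≤ (d : ℤ) * (Z.card - q) := by
    have : (q : ℤ) ≤ Z.card := by exact_mod_cast hqN
    exact mul_nonneg (by positivity) (by linarith)
  calc (Z.card : ℤ) * (Z.card - 1) = ∑ p ∈ Z, ((Z.card : ℤ) - 1) := by
        rw [Finset.sum_const, nsmul_eq_mul]
    _ ≤ ∑ p ∈ Z, ((d ^ 2 - 1 : ℤ) + ∑ α ∈ Badᶜ, ((L α (p.2 - α * p.1) : ℤ) - 1)) :=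
        Finset.sum_le_sum hpt
    _ = Z.card * (d ^ 2 - 1) + ∑ α ∈ Badᶜ, ∑ p ∈ Z, ((L α (p.2 - α * p.1) : ℤ) - 1) := by
        rw [Finset.sum_add_distrib, Finset.sum_comm, Finset.sum_const, nsmul_eq_mul]
    _ ≤ Z.card * (d ^ 2 - 1) + ∑ α ∈ Badᶜ, (d : ℤ) * (Z.card - q) := by
        gcongr with α hα
        exact hgood α hα
    _ ≤ _ := by
        rw [Finset.sum_const, nsmul_eq_mul]
        gcongr
        exact Finset.card_le_univ _

end Comb

lemma final_numeric (d q N r : ℕ) (hd : 4 ≤ d)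
    (hq : (q : ℝ) > ((1 + Real.sqrt 2) / 2) ^ 2 * (d : ℝ) ^ 2 * ((d : ℝ) - 1) ^ 2 * ((d : ℝ) - 2) ^ 2)
    (hr : r = ⌈Real.sqrt q⌉₊) (hN : N ≤ (r + 1) ^ 2 + r * (d * (d - 2)) + d * (d - 1)) (hqN : q ≤ N)
    (h : (N : ℤ) * (N - 1) ≤ N * (d ^ 2 - 1) + q * (d * (N - q))) : False := by
  obtain ⟨s, hs⟩ : ∃ s : ℝ, s = Real.sqrt q := ⟨_, rfl⟩
  have hs0 : 0 ≤ s := hs ▸ Real.sqrt_nonneg _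
  have hsq : s ^ 2 = q := by rw [hs]; exact Real.sq_sqrt (by positivity)
  have hrs : (r : ℝ) ≤ s + 1 := by rw [hr, hs]; exact (Nat.ceil_lt_add_one (Real.sqrt_nonneg _)).le
  have hD : (4 : ℝ) ≤ d := by exact_mod_cast hd
  obtain ⟨D, hDd⟩ : ∃ D : ℝ, D = d := ⟨_, rfl⟩
  rw [← hDd] at hD hq
  obtain ⟨m, hm⟩ : ∃ m : ℝ, m = D * (D - 1) * (D - 2) := ⟨_, rfl⟩
  have hm24 : 24 ≤ m := by rw [hm]; nlinarith [mul_nonneg (sub_nonneg.2 hD) (sub_nonneg.2 hD)]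
  have hsm : 6 / 5 * m ≤ s := by
    have h2 : (7 / 5 : ℝ) ≤ Real.sqrt 2 := by
      apply Real.le_sqrt_of_sq_le; norm_num
    have h3 : (6 / 5 * m) ^ 2 ≤ s ^ 2 := by
      rw [hsq]
      refine le_trans ?_ hq.le
      have : ((1 + Real.sqrt 2) / 2) ^ 2 * D ^ 2 * (D - 1) ^ 2 * (D - 2) ^ 2 =
        ((1 + Real.sqrt 2) / 2 * m) ^ 2 := by rw [hm]; ring
      rw [this]
      apply pow_le_pow_left₀ (by linarith)
      apply mul_le_mul_of_nonneg_right _ (by linarith)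
      linarith
    exact (pow_le_pow_iff_left₀ (by linarith) hs0 two_ne_zero).1 h3
  obtain ⟨t, ht⟩ : ∃ t : ℝ, t = N - q := ⟨_, rfl⟩
  have ht0 : 0 ≤ t := by
    have : (q : ℝ) ≤ N := by exact_mod_cast hqN
    linarith
  have hNR : (N : ℝ) ≤ (s + 2) ^ 2 + (s + 1) * (D * (D - 2)) + D * (D - 1) := by
    have h1 : (N : ℝ) ≤ ((r : ℝ) + 1) ^ 2 + r * (D * (D - 2)) + D * (D - 1) := by
      have : (N : ℝ) ≤ (((r + 1) ^ 2 + r * (d * (d - 2)) + d * (d - 1) : ℕ) : ℝ) := by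
        exact_mod_cast hN
      rw [hDd]
      push_cast [Nat.cast_sub (show 2 ≤ d by omega), Nat.cast_sub (show 1 ≤ d by omega)] at this
      exact this
    have h2 : 0 ≤ D * (D - 2) := by nlinarith
    have h3 : ((r : ℝ) + 1) ^ 2 ≤ (s + 2) ^ 2 := by
      apply pow_le_pow_left₀ (by positivity); linarith
    have h4 := mul_le_mul_of_nonneg_right hrs h2
    linarith
  have htle : t ≤ s * (D ^ 2 - 2 * D + 4) + (2 * D ^ 2 - 3 * D + 4) := by
    rw [ht, ← hsq]; nlinarith
  have hh : ((N : ℝ)) * (N - 1) ≤ N * (D ^ 2 - 1) + q * (D * (N - q)) := by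
    rw [hDd]; exact_mod_cast h
  have hNt : (N : ℝ) = s ^ 2 + t := by rw [ht, hsq]; ring
  rw [hNt, ← hsq] at hh
  -- (q+t)(q+t-d^2) ≤ d q t
  have h1 : (D - 2) * t ≤ m * s + (D - 2) * (2 * D ^ 2 - 3 * D + 4) := by
    have e1 := mul_le_mul_of_nonneg_left htle (show 0 ≤ D - 2 by linarith)
    have e2 : (D - 2) * (D ^ 2 - 2 * D + 4) ≤ m := by
      rw [hm]; nlinarith
    have e3 := mul_le_mul_of_nonneg_right e2 hs0
    linarith
  have h2 : (D - 2) * (2 * D ^ 2 - 3 * D + 4) + 3 / 2 * D ^ 2 + 1 ≤ 24 / 100 * m ^ 2 := by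
    have e1 : 24 * m ≤ m ^ 2 := by
      rw [sq]; exact mul_le_mul_of_nonneg_right hm24 (by linarith)
    have e2 : (D - 2) * (2 * D ^ 2 - 3 * D + 4) + 3 / 2 * D ^ 2 + 1 ≤ 576 / 100 * m := by
      rw [hm]
      obtain ⟨z, hz⟩ : ∃ z, z = D - 4 := ⟨_, rfl⟩
      have hz0 : 0 ≤ z := by linarith
      have : D = z + 4 := by linarith
      rw [this]
      have z2 := pow_nonneg hz0 2
      have z3 := pow_nonneg hz0 3
      linarith
    linarith
  have h3 : 24 / 100 * m ^ 2 ≤ s * (s - m) := by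
    calc 24 / 100 * m ^ 2 = (6 / 5 * m) * (1 / 5 * m) := by ring
      _ ≤ s * (s - m) := mul_le_mul hsm (by linarith) (by linarith) hs0
  have h4 : (D - 2) * t + 3 / 2 * D ^ 2 + 1 ≤ s ^ 2 := by linarith
  have h5 : 2 * t ≤ s ^ 2 := by
    have := mul_le_mul_of_nonneg_right (show 2 ≤ D - 2 by linarith) ht0
    linarith [sq_nonneg D]
  have hq0 : 0 ≤ s ^ 2 := sq_nonneg s
  have h6 := mul_le_mul_of_nonneg_left h4 hq0
  have h7 := mul_le_mul_of_nonneg_left h5 (sq_nonneg D)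
  have h8 : 0 < s ^ 2 := pow_pos (by linarith) 2
  linarith [sq_nonneg t]

end LineAvoid

namespace LineAvoid
open Polynomial
section Sh
variable {σ : Type*} {R S : Type*} [CommRing R] [CommRing S]

/-- `P (y v + w)` as a polynomial in `y` -/
noncomputable def shP (P : MvPolynomial σ R) (v w : σ → R) : R[X] :=
  MvPolynomial.eval₂ (C : R →+* R[X]) (fun i => C (v i) * X + C (w i)) P

lemma shP_map (φ : R →+* S) (P : MvPolynomial σ R) (v w : σ → R) :
    (shP P v w).map φ = shP (MvPolynomial.map φ P) (fun i => φ (v i)) (fun i => φ (w i)) := by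
  have := MvPolynomial.hom_eval₂ P (C : R →+* R[X]) (mapRingHom φ) (fun i => C (v i) * X + C (w i))
  rw [coe_mapRingHom] at this
  rw [shP, this, shP, MvPolynomial.eval₂_map]
  congr 1
  · ext; simp
  · funext i; simp

lemma shP_eval (P : MvPolynomial σ R) (v w : σ → R) (y : R) :
    (shP P v w).eval y = MvPolynomial.eval (fun i => v i * y + w i) P := by
  have := MvPolynomial.hom_eval₂ P (C : R →+* R[X]) (evalRingHom y) (fun i => C (v i) * X + C (w i))
  rw [coe_evalRingHom] at this
  rw [shP, this, MvPolynomial.eval, MvPolynomial.coe_eval₂Hom]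
  congr 1
  · ext; simp
  · funext i; simp

lemma coeff_prod_sum_le {ι : Type*} (s : Finset ι) (e : ι → ℕ) (a : ι → R[X])
    (h : ∀ i, (a i).natDegree ≤ e i) :
    (∏ i ∈ s, a i).coeff (∑ i ∈ s, e i) = ∏ i ∈ s, (a i).coeff (e i) := by
  classical
  induction s using Finset.induction_on with
  | empty => simp
  | insert i s hi ih =>
    rw [Finset.sum_insert hi, Finset.prod_insert hi, Finset.prod_insert hi, ← ih]
    exact coeff_mul_add_eq_of_natDegree_le (h i)
      ((natDegree_prod_le _ _).trans (Finset.sum_le_sum fun i _ => h i))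

lemma shP_deg_coeff (P : MvPolynomial σ R) {d : ℕ} (hP : P.IsHomogeneous d) (v w : σ → R) :
    (shP P v w).natDegree ≤ d ∧ (shP P v w).coeff d = MvPolynomial.eval v P := by
  rw [shP, MvPolynomial.eval₂_eq, MvPolynomial.eval_eq]
  have key : ∀ m ∈ P.support, (∏ i ∈ m.support, (C (v i) * X + C (w i)) ^ m i).natDegree ≤ d ∧
      (∏ i ∈ m.support, (C (v i) * X + C (w i)) ^ m i).coeff d = ∏ i ∈ m.support, v i ^ m i := by
    intro m hm
    have hd : ∑ i ∈ m.support, m i = d := by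
      have := hP (MvPolynomial.mem_support_iff.1 hm)
      rw [← this, Finsupp.weight_apply, Finsupp.sum]; simp
    have h1 : ∀ i, ((C (v i) * X + C (w i)) ^ m i).natDegree ≤ m i := by
      intro i
      exact (natDegree_pow_le).trans (by
        have : (C (v i) * X + C (w i)).natDegree ≤ 1 := natDegree_linear_le
        nlinarith)
    constructor
    · exact (natDegree_prod_le _ _).trans (by rw [← hd]; exact Finset.sum_le_sum fun i _ => h1 i)
    · rw [← hd, coeff_prod_sum_le _ _ _ h1]
      refine Finset.prod_congr rfl fun i _ => ?_
      have := coeff_pow_of_natDegree_le (p := C (v i) * X + C (w i)) (n := 1) (m := m i)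
        natDegree_linear_le
      rw [mul_one] at this
      rw [this]
      simp
  constructor
  · refine natDegree_sum_le_of_forall_le _ _ fun m hm => ?_
    exact (natDegree_C_mul_le _ _).trans (key m hm).1
  · rw [finsetSum_coeff]
    exact Finset.sum_congr rfl fun m hm => by rw [coeff_C_mul, (key m hm).2]

lemma shP_derivative [Fintype σ] (P : MvPolynomial σ R) (v w : σ → R) :
    derivative (shP P v w) = ∑ i, C (v i) * shP (MvPolynomial.pderiv i P) v w := by
  classical
  have hmul : ∀ p q : MvPolynomial σ R, shP (p * q) v w = shP p v w * shP q v w := fun p q =>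
    MvPolynomial.eval₂_mul _ _
  have hadd : ∀ p q : MvPolynomial σ R, shP (p + q) v w = shP p v w + shP q v w := fun p q =>
    MvPolynomial.eval₂_add _ _
  have hC : ∀ a : R, shP (MvPolynomial.C a : MvPolynomial σ R) v w = C a := fun a =>
    MvPolynomial.eval₂_C _ _ _
  have hX : ∀ i : σ, shP (MvPolynomial.X i : MvPolynomial σ R) v w = C (v i) * X + C (w i) := fun i =>
    MvPolynomial.eval₂_X _ _ _
  induction P using MvPolynomial.induction_on with
  | C a => 
    have h0 : shP (0 : MvPolynomial σ R) v w = 0 := MvPolynomial.eval₂_zero _ _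
    simp [hC, h0]
  | add p q hp hq => simp only [hadd, map_add, hp, hq, mul_add, Finset.sum_add_distrib]
  | mul_X p j hp =>
    have : ∀ i, shP (Pi.single (M := fun _ => MvPolynomial σ R) i 1 j) v w = if i = j then 1 else 0 := by
      intro i
      by_cases h : i = j
      · subst h; rw [Pi.single_eq_same, if_pos rfl]; simpa using hC 1
      · rw [Pi.single_eq_of_ne (Ne.symm h), if_neg h]; exact MvPolynomial.eval₂_zero _ _
    rw [hmul, derivative_mul, hp]
    have h2 : ∀ i, C (v i) * shP (MvPolynomial.pderiv i (p * MvPolynomial.X j)) v w =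
        (C (v i) * shP (MvPolynomial.pderiv i p) v w) * shP (MvPolynomial.X j) v w +
          if i = j then C (v i) * shP p v w else 0 := by
      intro i
      rw [MvPolynomial.pderiv_mul, hadd, hmul, hmul, MvPolynomial.pderiv_X, this]
      split_ifs <;> ring
    rw [Finset.sum_congr rfl fun i _ => h2 i, Finset.sum_add_distrib, ← Finset.sum_mul, hX]
    simp
    ring

end Sh

section Line
variable {σ : Type*} {R S : Type*} [CommRing R] [CommRing S]

/-- `P (y v + p + x u)` as a polynomial in `y` over polynomials in `x` -/
noncomputable def lineP (P : MvPolynomial σ R) (v p u : σ → R) : R[X][X] :=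
  shP (MvPolynomial.map C P) (fun i => C (v i)) (fun i => C (p i) + C (u i) * X)

lemma lineP_map (φ : R →+* S) (P : MvPolynomial σ R) (v p u : σ → R) :
    (lineP P v p u).map (mapRingHom φ) = lineP (MvPolynomial.map φ P) (fun i => φ (v i))
      (fun i => φ (p i)) (fun i => φ (u i)) := by
  rw [lineP, shP_map, lineP, MvPolynomial.map_map, MvPolynomial.map_map]
  have : (mapRingHom φ).comp (C : R →+* R[X]) = (C : S →+* S[X]).comp φ := by
    ext; simp
  rw [this]
  congr 1
  · funext i; simp
  · funext i; simp

lemma lineP_eval (P : MvPolynomial σ R) (v p u : σ → R) (x : R) :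
    (lineP P v p u).map (evalRingHom x) = shP P v (fun i => p i + u i * x) := by
  rw [lineP, shP_map, MvPolynomial.map_map]
  congr 1
  · convert MvPolynomial.map_id P
    ext; simp
  · funext i; simp
  · funext i; simp

lemma lineP_coeff_deg (P : MvPolynomial σ R) {d : ℕ} (hP : P.IsHomogeneous d) (v p u : σ → R) :
    (lineP P v p u).natDegree ≤ d ∧ (lineP P v p u).coeff d = C (MvPolynomial.eval v P) := by
  have := shP_deg_coeff (MvPolynomial.map C P) (hP.map C) (fun i => C (v i))
    (fun i => C (p i) + C (u i) * X)
  refine ⟨this.1, this.2.trans ?_⟩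
  rw [MvPolynomial.eval_map]
  exact (MvPolynomial.eval₂_comp_left (C : R →+* R[X]) (RingHom.id R) v P).symm

/-- bounded total degree -/
def Tot (D : ℕ) (a : R[X][X]) : Prop := ∀ i j, D < i + j → (a.coeff j).coeff i = 0

lemma Tot.mul {D E : ℕ} {a b : R[X][X]} (ha : Tot D a) (hb : Tot E b) : Tot (D + E) (a * b) := by
  intro i j hij
  rw [coeff_mul, finsetSum_coeff]
  refine Finset.sum_eq_zero fun x hx => ?_
  rw [coeff_mul]
  refine Finset.sum_eq_zero fun z hz => ?_
  rw [Finset.HasAntidiagonal.mem_antidiagonal] at hx hz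
  by_cases h : D < z.1 + x.1
  · rw [ha _ _ h, zero_mul]
  · rw [hb _ _ (by omega), mul_zero]

lemma Tot.pow {D : ℕ} {a : R[X][X]} (ha : Tot D a) (m : ℕ) : Tot (m * D) (a ^ m) := by
  induction m with
  | zero =>
    intro i j hij
    rw [pow_zero, coeff_one]
    split_ifs with h
    · rw [coeff_one, if_neg (by omega)]
    · simp
  | succ m ih => rw [pow_succ, Nat.succ_mul]; exact ih.mul ha

lemma Tot.prod {ι : Type*} (s : Finset ι) (e : ι → ℕ) (a : ι → R[X][X]) (h : ∀ i, Tot (e i) (a i)) :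
    Tot (∑ i ∈ s, e i) (∏ i ∈ s, a i) := by
  classical
  induction s using Finset.induction_on with
  | empty => simpa using Tot.pow (D := 0) (a := (0 : R[X][X])) (by intro i j _; simp) 0
  | insert i s hi ih => rw [Finset.sum_insert hi, Finset.prod_insert hi]; exact (h i).mul ih

lemma lineP_tot (P : MvPolynomial σ R) {d : ℕ} (hP : P.IsHomogeneous d) (v p u : σ → R) :
    Tot d (lineP P v p u) := by
  rw [lineP, shP, MvPolynomial.eval₂_map, MvPolynomial.eval₂_eq]
  intro a b hab
  rw [finsetSum_coeff, finsetSum_coeff]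
  refine Finset.sum_eq_zero fun m hm => ?_
  have hd : ∑ i ∈ m.support, m i * 1 = d := by
    have := hP (MvPolynomial.mem_support_iff.1 hm)
    rw [← this, Finsupp.weight_apply, Finsupp.sum]; simp
  have h1 : Tot d (∏ i ∈ m.support, (C (C (v i)) * X + C (C (p i) + C (u i) * X)) ^ m i) := by
    rw [← hd]
    apply Tot.prod
    intro i
    apply Tot.pow
    intro i' j hij
    rcases j with _ | _ | j
    · simp [coeff_X, coeff_C]
      rw [if_neg (by omega), if_neg (by omega)]; simp
    · simp [coeff_X, coeff_C]
      omega
    · simp [coeff_X, coeff_C]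
  simp only [RingHom.coe_comp, Function.comp_apply, coeff_C_mul]
  rw [h1 a b hab, mul_zero]

end Line
end LineAvoid

namespace LineAvoid
open Polynomial
section Rational
variable {σ : Type*} [Fintype σ] {k K : Type*} [Field k] [Fintype k] [Field K] [Algebra k K]

lemma exists_rational_ne (h : MvPolynomial σ K) (h0 : h ≠ 0) (hd : h.totalDegree < Fintype.card k) :
    ∃ v : σ → k, MvPolynomial.eval (fun i => algebraMap k K (v i)) h ≠ 0 := by
  classical
  by_contra! hcon
  apply h0
  refine MvPolynomial.eq_zero_of_eval_zero_at_prod_finset h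
    (fun _ => Finset.univ.image (algebraMap k K)) ?_ ?_
  · intro i
    rw [Finset.card_image_of_injective _ (algebraMap k K).injective, Finset.card_univ]
    exact (MvPolynomial.degreeOf_le_totalDegree _ _).trans_lt hd
  · intro x hx
    have : ∀ i, ∃ a, algebraMap k K a = x i := fun i => by
      simpa using hx i
    choose v hv using this
    have := hcon v
    simpa [hv] using this

end Rational

section Det
variable {σ : Type*} {R : Type*} [CommRing R]

lemma totalDegree_det_le {ι : Type*} [Fintype ι] [DecidableEq ι] (M : Matrix ι ι (MvPolynomial σ R))
    (e : ℕ) (h : ∀ i j, (M i j).totalDegree ≤ e) : M.det.totalDegree ≤ Fintype.card ι * e := by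
  rw [Matrix.det_apply]
  refine (MvPolynomial.totalDegree_finsetSum _ _).trans (Finset.sup_le fun τ _ => ?_)
  have h1 : (∏ i, M (τ i) i).totalDegree ≤ Fintype.card ι * e := by
    refine (MvPolynomial.totalDegree_finsetProd _ _).trans ?_
    refine (Finset.sum_le_sum fun i _ => h (τ i) i).trans ?_
    simp
  rcases Int.units_eq_one_or (Equiv.Perm.sign τ) with hs | hs <;> rw [hs]
  · simpa using h1
  · simpa [MvPolynomial.totalDegree_neg] using h1

end Det

section Shift
variable {σ : Type*} {K : Type*} [Field K]

/-- substitution `w ↦ w + p + y v` -/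
noncomputable def shHom (v p : σ → K) : (MvPolynomial σ K)[X] →ₐ[K] (MvPolynomial σ K)[X] :=
  Polynomial.aevalTower (MvPolynomial.aeval fun i => C (MvPolynomial.C (v i)) * X +
    C (MvPolynomial.X i + MvPolynomial.C (p i))) X

lemma shHom_inv (v p : σ → K) (a : (MvPolynomial σ K)[X]) :
    shHom (fun i => - v i) (fun i => - p i) (shHom v p a) = a := by
  have : (shHom (fun i => - v i) (fun i => - p i)).comp (shHom v p) = AlgHom.id K _ := by
    apply Polynomial.algHom_ext'
    · apply MvPolynomial.algHom_ext
      intro i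
      simp [shHom]
      ring
    · simp [shHom]
  exact DFunLike.congr_fun this a

noncomputable def shEquiv (v p : σ → K) : (MvPolynomial σ K)[X] ≃* (MvPolynomial σ K)[X] where
  toFun := shHom v p
  invFun := shHom (fun i => - v i) (fun i => - p i)
  left_inv := shHom_inv v p
  right_inv := by
    intro a
    simpa using shHom_inv (fun i => - v i) (fun i => - p i) a
  map_mul' := map_mul _

lemma shHom_C (v p : σ → K) (P : MvPolynomial σ K) :
    shHom v p (C P) = shP (MvPolynomial.map MvPolynomial.C P) (fun i => MvPolynomial.C (v i))
      (fun i => MvPolynomial.X i + MvPolynomial.C (p i)) := by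
  rw [shHom, shP, MvPolynomial.eval₂_map]
  simp [MvPolynomial.aeval_def]
  rfl

lemma shP_irreducible (v p : σ → K) (P : MvPolynomial σ K) (hP : Irreducible P) :
    Irreducible (shP (MvPolynomial.map MvPolynomial.C P) (fun i => MvPolynomial.C (v i))
      (fun i => MvPolynomial.X i + MvPolynomial.C (p i))) := by
  rw [← shHom_C]
  exact (MulEquiv.irreducible_iff (shEquiv v p)).2 ((Polynomial.prime_C_iff.2 hP.prime).irreducible)

lemma shP_ne_zero (v p : σ → K) (P : MvPolynomial σ K) (hP : P ≠ 0) :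
    shP (MvPolynomial.map MvPolynomial.C P) (fun i => MvPolynomial.C (v i))
      (fun i => MvPolynomial.X i + MvPolynomial.C (p i)) ≠ 0 := by
  rw [← shHom_C]
  intro h
  have := congrArg (shHom (fun i => - v i) (fun i => - p i)) h
  rw [shHom_inv, map_zero, C_eq_zero] at this
  exact hP this

end Shift

section ChooseV
variable {σ : Type*} [Fintype σ] {k K : Type*} [Field k] [Fintype k] [Field K] [IsAlgClosed K]
  [Algebra k K]

lemma exists_pderiv_ne (p : ℕ) [Fact p.Prime] [CharP K p] (P : MvPolynomial σ K)
    (hP : Irreducible P) : ∃ j, MvPolynomial.pderiv j P ≠ 0 := by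
  by_contra! hcon
  have hp : p.Prime := Fact.out
  have hdvd : ∀ m ∈ P.support, ∀ i, p ∣ m i := by
    intro m hm i
    by_cases h0 : m i = 0
    · rw [h0]; exact dvd_zero _
    have h1 := MvPolynomial.coeff_pderiv (i := i) P (m - Finsupp.single i 1)
    have hle : Finsupp.single i 1 ≤ m := by
      rw [Finsupp.single_le_iff]; omega
    rw [hcon i, MvPolynomial.coeff_zero, tsub_add_cancel_of_le hle] at h1
    have h2 : ((m i : ℕ) : K) = 0 := by
      rcases mul_eq_zero.1 h1.symm with h | h
      · exact absurd h (MvPolynomial.mem_support_iff.1 hm)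
      · simp only [Finsupp.coe_tsub, Pi.sub_apply, Finsupp.single_eq_same] at h
        rw [Nat.cast_sub (by omega)] at h
        simpa using h
    exact (CharP.cast_eq_zero_iff K p _).1 h2
  have hroot : ∀ c : K, ∃ z, z ^ p = c := fun c => IsAlgClosed.exists_pow_nat_eq c hp.pos
  choose rt hrt using hroot
  have hPe : P = (∑ m ∈ P.support, MvPolynomial.monomial
      (m.mapRange (fun a => a / p) (by simp)) (rt (P.coeff m))) ^ p := by
    have : CharP (MvPolynomial σ K) p := inferInstance
    rw [sum_pow_char]
    conv_lhs => rw [P.as_sum]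
    refine Finset.sum_congr rfl fun m hm => ?_
    rw [MvPolynomial.monomial_pow, hrt]
    have : p • m.mapRange (fun a => a / p) (by simp) = m := by
      ext i
      simp [Nat.mul_div_cancel' (hdvd m hm i)]
    rw [this]
  rw [hPe] at hP
  exact not_irreducible_pow hp.ne_one hP

lemma exists_v (P : MvPolynomial σ K) (hP : Irreducible P) {d : ℕ} (hd : P.totalDegree ≤ d)
    (hq : d + 1 < Fintype.card k) : ∃ v : σ → k,
      MvPolynomial.eval (fun i => algebraMap k K (v i)) P ≠ 0 ∧
      ∑ i, MvPolynomial.C (algebraMap k K (v i)) * MvPolynomial.pderiv i P ≠ 0 := by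
  obtain ⟨p, hpc⟩ := CharP.exists k
  have : Fact p.Prime := ⟨(CharP.char_is_prime_or_zero k p).resolve_right (CharP.char_ne_zero_of_finite k p)⟩
  have : CharP K p := charP_of_injective_algebraMap (algebraMap k K).injective p
  obtain ⟨j, hj⟩ := exists_pderiv_ne p P hP
  obtain ⟨m, hm⟩ := MvPolynomial.ne_zero_iff.1 hj
  obtain ⟨l, hl⟩ : ∃ l : MvPolynomial σ K, l = ∑ i, MvPolynomial.C (MvPolynomial.coeff m
    (MvPolynomial.pderiv i P)) * MvPolynomial.X i := ⟨_, rfl⟩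
  have hl1 : ∀ w : σ → K, MvPolynomial.eval w l = MvPolynomial.coeff m
      (∑ i, MvPolynomial.C (w i) * MvPolynomial.pderiv i P) := by
    intro w
    rw [hl, map_sum, MvPolynomial.coeff_sum]
    refine Finset.sum_congr rfl fun i _ => ?_
    rw [MvPolynomial.coeff_C_mul]; simp [mul_comm]
  have hl0 : l ≠ 0 := by
    classical
    intro h0
    have := hl1 (Pi.single j 1)
    rw [h0, map_zero, Finset.sum_eq_single j] at this
    · apply hm; simpa using this.symm
    · intro b _ hb; simp [hb]
    · simp
  have hld : l.totalDegree ≤ 1 := by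
    rw [hl]
    refine MvPolynomial.totalDegree_finsetSum_le fun i _ => ?_
    refine (MvPolynomial.totalDegree_mul _ _).trans ?_
    simp [MvPolynomial.totalDegree_X]
  obtain ⟨v, hv⟩ := exists_rational_ne (k := k) (P * l) (mul_ne_zero hP.ne_zero hl0)
    ((MvPolynomial.totalDegree_mul _ _).trans_lt (by omega))
  rw [map_mul] at hv
  refine ⟨v, left_ne_zero_of_mul hv, fun h => right_ne_zero_of_mul hv ?_⟩
  rw [hl1, h, MvPolynomial.coeff_zero]

end ChooseV
end LineAvoid

namespace LineAvoid
open Polynomial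
section TotA
variable {σ : Type*} {R : Type*} [CommRing R]

/-- all coefficients have bounded total degree -/
def TotA (D : ℕ) (a : (MvPolynomial σ R)[X]) : Prop := ∀ j, (a.coeff j).totalDegree ≤ D

lemma TotA.mul {D E : ℕ} {a b : (MvPolynomial σ R)[X]} (ha : TotA D a) (hb : TotA E b) :
    TotA (D + E) (a * b) := by
  intro j
  rw [coeff_mul]
  refine MvPolynomial.totalDegree_finsetSum_le fun x _ => ?_
  exact (MvPolynomial.totalDegree_mul _ _).trans (add_le_add (ha _) (hb _))

lemma TotA.one : TotA 0 (1 : (MvPolynomial σ R)[X]) := by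
  intro j
  rw [coeff_one]
  split_ifs <;> simp

lemma TotA.pow {D : ℕ} {a : (MvPolynomial σ R)[X]} (ha : TotA D a) (m : ℕ) :
    TotA (m * D) (a ^ m) := by
  induction m with
  | zero => simpa using TotA.one
  | succ m ih => rw [pow_succ, Nat.succ_mul]; exact ih.mul ha

lemma TotA.prod {ι : Type*} (s : Finset ι) (e : ι → ℕ) (a : ι → (MvPolynomial σ R)[X])
    (h : ∀ i, TotA (e i) (a i)) :
    TotA (∑ i ∈ s, e i) (∏ i ∈ s, a i) := by
  classical
  induction s using Finset.induction_on with
  | empty => simpa using TotA.one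
  | insert i s hi ih => rw [Finset.sum_insert hi, Finset.prod_insert hi]; exact (h i).mul ih

lemma shP_totA (P : MvPolynomial σ R) {d : ℕ} (hP : P.IsHomogeneous d) (v p : σ → R) :
    TotA d (shP (MvPolynomial.map MvPolynomial.C P) (fun i => MvPolynomial.C (v i))
      (fun i => MvPolynomial.X i + MvPolynomial.C (p i))) := by
  rw [shP, MvPolynomial.eval₂_map, MvPolynomial.eval₂_eq]
  intro b
  rw [finsetSum_coeff]
  refine MvPolynomial.totalDegree_finsetSum_le fun m hm => ?_
  have hd : ∑ i ∈ m.support, m i * 1 = d := by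
    have := hP (MvPolynomial.mem_support_iff.1 hm)
    rw [← this, Finsupp.weight_apply, Finsupp.sum]; simp
  have h1 : TotA d (∏ i ∈ m.support, (C (MvPolynomial.C (v i)) * X +
      C (MvPolynomial.X i + MvPolynomial.C (p i) : MvPolynomial σ R)) ^ m i) := by
    rw [← hd]
    apply TotA.prod
    intro i
    apply TotA.pow
    intro j
    have hX : (MvPolynomial.X i + MvPolynomial.C (p i) : MvPolynomial σ R).totalDegree ≤ 1 := by
      refine (MvPolynomial.totalDegree_add _ _).trans (max_le ?_ (by simp))
      exact (MvPolynomial.totalDegree_monomial_le _ _).trans (by simp)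
    rcases j with _ | _ | j
    · simpa using hX
    · simp [coeff_C]
    · simp [coeff_X, coeff_C]
  simp only [RingHom.coe_comp, Function.comp_apply, coeff_C_mul]
  refine (MvPolynomial.totalDegree_mul _ _).trans ?_
  simpa using h1 b

end TotA

section ChooseP
variable {σ : Type*} [Fintype σ] {k K : Type*} [Field k] [Fintype k] [Field K] [Algebra k K]

lemma exists_p (P : MvPolynomial σ K) {d : ℕ} (hP : Irreducible P) (hhom : P.IsHomogeneous d)
    (v : σ → K) (hv : MvPolynomial.eval v P = 1)
    (hD : ∑ i, MvPolynomial.C (v i) * MvPolynomial.pderiv i P ≠ 0)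
    (hq : 2 * d * d < Fintype.card k) :
    ∃ p : σ → k, ∀ y : K, (shP P v (fun i => algebraMap k K (p i))).eval y = 0 →
      (derivative (shP P v (fun i => algebraMap k K (p i)))).eval y ≠ 0 := by
  obtain ⟨f, hf⟩ : ∃ f, f = shP (MvPolynomial.map MvPolynomial.C P) (fun i => MvPolynomial.C (v i))
      (fun i => MvPolynomial.X i + MvPolynomial.C 0) := ⟨_, rfl⟩
  have hirr : Irreducible f := hf ▸ shP_irreducible v (fun _ => 0) P hP
  have hdc := shP_deg_coeff (MvPolynomial.map (MvPolynomial.C (σ := σ)) P) (hhom.map _)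
    (fun i => MvPolynomial.C (v i)) (fun i => MvPolynomial.X i + MvPolynomial.C 0)
  rw [← hf] at hdc
  have hlead : f.coeff d = 1 := by
    rw [hdc.2, MvPolynomial.eval_map]
    have := MvPolynomial.eval₂_comp_left (MvPolynomial.C (σ := σ) : K →+* _) (RingHom.id K) v P
    rw [RingHom.comp_id] at this
    have h2 : MvPolynomial.eval₂ (RingHom.id K) v P = 1 := hv
    rw [h2, map_one] at this
    exact this.symm
  have hmon : f.Monic := monic_of_natDegree_le_of_coeff_eq_one d hdc.1 hlead
  have hder : derivative f ≠ 0 := by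
    have h1 : derivative f = shP (MvPolynomial.map MvPolynomial.C
        (∑ i, MvPolynomial.C (v i) * MvPolynomial.pderiv i P)) (fun i => MvPolynomial.C (v i))
      (fun i => MvPolynomial.X i + MvPolynomial.C 0) := by
      rw [hf, shP_derivative, map_sum, shP, ← MvPolynomial.coe_eval₂Hom, map_sum]
      refine Finset.sum_congr rfl fun i _ => ?_
      rw [map_mul, map_mul, MvPolynomial.pderiv_map]
      simp [shP]
    rw [h1]
    exact shP_ne_zero v (fun _ => 0) _ hD
  let ι := algebraMap (MvPolynomial σ K) (FractionRing (MvPolynomial σ K))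
  have hι : Function.Injective ι := IsFractionRing.injective _ _
  have hirrL : Irreducible (f.map ι) :=
    (Monic.irreducible_iff_irreducible_map_fraction_map hmon).1 hirr
  have hcop : IsCoprime (f.map ι) ((derivative f).map ι) := by
    have := (separable_iff_derivative_ne_zero hirrL).2 (by
      rw [derivative_map]
      exact (Polynomial.map_ne_zero_iff hι).2 hder)
    rwa [Separable, derivative_map] at this
  have hres : resultant f (derivative f) ≠ 0 := by
    intro h0
    have h1 := resultant_map_map f (derivative f) f.natDegree (derivative f).natDegree ι
    rw [h0, map_zero] at h1
    have h2 : resultant (f.map ι) ((derivative f).map ι) = 0 := by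
      rw [natDegree_map_eq_of_injective hι, natDegree_map_eq_of_injective hι]; exact h1
    exact (resultant_eq_zero_iff.1 h2).2 hcop
  have htot : TotA d f := hf ▸ shP_totA P hhom v (fun _ => 0)
  have hdeg : (resultant f (derivative f)).totalDegree < Fintype.card k := by
    refine lt_of_le_of_lt (totalDegree_det_le _ d ?_) ?_
    · intro i j
      rw [sylvester, Matrix.of_apply]
      induction j using Fin.addCases with
      | left j =>
        rw [Fin.addCases_left]
        split_ifs
        · rw [coeff_derivative]
          refine (MvPolynomial.totalDegree_mul _ _).trans ?_
          have h3 : ((i - j : ℕ) + 1 : MvPolynomial σ K).totalDegree = 0 := by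
            have := MvPolynomial.totalDegree_C (σ := σ) (((i - j : ℕ) : K) + 1)
            simpa using this
          rw [h3]; exact htot _
        · simp
      | right j =>
        rw [Fin.addCases_right]
        split_ifs
        · exact htot _
        · simp
    · rw [Fintype.card_fin]
      have h4 : (derivative f).natDegree ≤ d := (natDegree_derivative_le f).trans (by omega)
      calc _ ≤ (d + d) * d := Nat.mul_le_mul_right _ (add_le_add hdc.1 h4)
        _ < _ := by rw [← two_mul]; exact hq
  obtain ⟨p, hp⟩ := exists_rational_ne (k := k) _ hres hdeg
  refine ⟨p, fun y hy hy' => hp ?_⟩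
  let ε : MvPolynomial σ K →+* K := MvPolynomial.eval (fun i => algebraMap k K (p i))
  have hfe : f.map ε = shP P v (fun i => algebraMap k K (p i)) := by
    rw [hf, shP_map, MvPolynomial.map_map]
    have : ε.comp MvPolynomial.C = RingHom.id K := by ext; simp [ε]
    rw [this, MvPolynomial.map_id]
    simp [ε]
  rw [← hfe] at hy hy'
  obtain ⟨a, b, -, -, hab⟩ := exists_mul_add_mul_eq_C_resultant f (derivative f) le_rfl le_rfl
    (Or.inl fun h => hder (derivative_of_natDegree_zero h))
  have := congrArg (fun z => (z.map ε).eval y) hab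
  simp only [Polynomial.map_add, Polynomial.map_mul, eval_add, eval_mul, hy, Polynomial.map_C, eval_C] at this
  rw [derivative_map] at hy'
  rw [hy'] at this
  simpa using this.symm
end ChooseP
end LineAvoid

namespace LineAvoid
open Polynomial
section Minor

lemma exists_minor {L ρ γ : Type*} [Field L] [Fintype ρ] [DecidableEq ρ] [Fintype γ]
    (M : Matrix ρ γ L) (h : LinearIndependent L M.row) :
    ∃ g : ρ → γ, (M.submatrix id g).det ≠ 0 := by
  have h1 : M.rank = Fintype.card ρ := LinearIndependent.rank_matrix h
  rw [Matrix.rank_eq_finrank_span_cols] at h1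
  obtain ⟨f, hf, -, hind⟩ := Submodule.exists_fun_fin_finrank_span_eq L (Set.range M.col)
  choose c hc using hf
  obtain ⟨e⟩ : Nonempty (ρ ≃ Fin (Module.finrank L (Submodule.span L (Set.range M.col)))) := by
    rw [h1]; exact ⟨Fintype.equivFin ρ⟩
  refine ⟨fun i => c (e i), ?_⟩
  have h2 : LinearIndependent L (M.submatrix id (fun i => c (e i))).col := by
    have h3 : (M.submatrix id (fun i => c (e i))).col = f ∘ e := by
      funext i
      rw [Function.comp_apply, ← hc]
      rfl
    rw [h3]
    exact hind.comp _ e.injective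
  rw [Matrix.linearIndependent_cols_iff_isUnit, Matrix.isUnit_iff_isUnit_det] at h2
  exact h2.ne_zero

lemma rows_indep_of_minor {L ρ γ : Type*} [Field L] [Fintype ρ] [DecidableEq ρ]
    (M : Matrix ρ γ L) (g : ρ → γ) (h : (M.submatrix id g).det ≠ 0) (c : ρ → L)
    (hc : ∀ m, ∑ i, c i * M i m = 0) : c = 0 := by
  have h1 : Matrix.vecMul c (M.submatrix id g) = 0 := by
    funext m
    simpa [Matrix.vecMul, dotProduct] using hc (g m)
  exact Matrix.eq_zero_of_vecMul_eq_zero h h1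

end Minor

section Swap
variable {K : Type*} [Field K]

lemma swap_coeff (a : K[X][X]) (i j : ℕ) :
    ((Bivariate.swap a).coeff i).coeff j = (a.coeff j).coeff i := by
  induction a using Polynomial.induction_on' with
  | add p q hp hq => simp only [map_add, coeff_add, hp, hq]
  | monomial n f =>
    induction f using Polynomial.induction_on' with
    | add p q hp hq => simp only [map_add, coeff_add, hp, hq]
    | monomial m r =>
      rw [Bivariate.swap_monomial_monomial]
      simp only [coeff_monomial]
      by_cases h1 : m = i <;> by_cases h2 : n = j <;> simp [h1, h2, coeff_monomial]

lemma tdeg_factor (a b f : K[X][X]) (hab : a * b = f) (hf0 : f ≠ 0) (D : ℕ)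
    (hf : ∀ i j, D < i → (f.coeff j).coeff i = 0) :
    ∀ i j, D < i → (a.coeff j).coeff i = 0 := by
  intro i j hi
  have h1 : (Bivariate.swap f).natDegree ≤ D := by
    rw [natDegree_le_iff_coeff_eq_zero]
    intro N hN
    ext j
    rw [swap_coeff, hf N j hN, coeff_zero]
  have h2 : Bivariate.swap f ≠ 0 := by
    rw [Ne, EmbeddingLike.map_eq_zero_iff]; exact hf0
  rw [← hab, map_mul] at h1 h2
  rw [natDegree_mul (left_ne_zero_of_mul h2) (right_ne_zero_of_mul h2)] at h1
  rw [← swap_coeff, coeff_eq_zero_of_natDegree_lt (p := Bivariate.swap a) (by omega), coeff_zero]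

end Swap

section Indep
variable {L : Type*} [Field L]

/-- the polynomial with given coefficients in a box -/
noncomputable def boxP (d : ℕ) (c : Fin (d + 1) × Fin d → L) : L[X][X] :=
  ∑ r : Fin (d + 1) × Fin d, monomial (r.2 : ℕ) (monomial (r.1 : ℕ) (c r))

lemma boxP_coeff (d : ℕ) (c : Fin (d + 1) × Fin d → L) (r : Fin (d + 1) × Fin d) :
    ((boxP d c).coeff r.2).coeff r.1 = c r := by
  rw [boxP, finsetSum_coeff, finsetSum_coeff, Finset.sum_eq_single r]
  · simp
  · intro b _ hb
    rw [coeff_monomial]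
    split_ifs with h
    · rw [coeff_monomial, if_neg]
      intro h2
      exact hb (Prod.ext (Fin.ext h2) (Fin.ext h))
    · simp
  · simp

lemma boxP_tot (d : ℕ) (c : Fin (d + 1) × Fin d → L) : Tot (2 * d - 1) (boxP d c) := by
  intro i j hij
  rw [boxP, finsetSum_coeff, finsetSum_coeff]
  refine Finset.sum_eq_zero fun r _ => ?_
  rw [coeff_monomial]
  split_ifs with h
  · rw [coeff_monomial, if_neg]
    have h1 := r.1.2
    have h2 := r.2.2
    omega
  · simp

lemma boxP_deg (d : ℕ) (hd : 0 < d) (c : Fin (d + 1) × Fin d → L) : (boxP d c).natDegree < d := by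
  have : (boxP d c).natDegree ≤ d - 1 := by
    refine natDegree_sum_le_of_forall_le _ _ fun r _ => ?_
    exact (natDegree_monomial_le _).trans (by have := r.2.2; omega)
  omega

lemma boxP_ev2 {A : Type*} [CommRing A] [Algebra L A] (d : ℕ) (c : Fin (d + 1) × Fin d → L) (x y : A) :
    ev2 (boxP d c) x y = ∑ r, c r • (x ^ (r.1 : ℕ) * y ^ (r.2 : ℕ)) := by
  rw [ev2, boxP, eval₂_finsetSum]
  refine Finset.sum_congr rfl fun r _ => ?_
  rw [eval₂_monomial]
  simp [aeval_monomial, Algebra.smul_def, mul_assoc]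

lemma curve_indep {f : L[X][X]} {d : ℕ} (hf : IsCurve f d) (hd : 0 < d) (Y : PowerSeries L)
    (hY : ev2 f (PowerSeries.X : PowerSeries L) Y = 0) :
    LinearIndependent L (fun (r : Fin (d + 1) × Fin d) (m : Fin (d * (2 * d - 1) + 1)) =>
      PowerSeries.coeff (m : ℕ) ((PowerSeries.X : PowerSeries L) ^ (r.1 : ℕ) * Y ^ (r.2 : ℕ))) := by
  rw [Fintype.linearIndependent_iff]
  intro c hc r
  by_contra hr
  obtain ⟨θ, hθ1, hθ2⟩ : ∃ θ : AdjoinRoot f →ₐ[L] PowerSeries L, θ (cx f) = PowerSeries.X ∧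
      θ (cy f) = Y := by
    refine ⟨AdjoinRoot.liftAlgHom f (aeval PowerSeries.X) Y ?_, ?_, ?_⟩
    · exact hY
    · exact (AdjoinRoot.liftAlgHom_of ..).trans (by simp)
    · exact AdjoinRoot.liftAlgHom_root ..
  have hne : boxP d c ≠ 0 := by
    intro h
    apply hr
    rw [← boxP_coeff d c r, h]; simp
  have hmk : AdjoinRoot.mk f (boxP d c) ≠ 0 :=
    AdjoinRoot.mk_ne_zero_of_natDegree_lt hf.monic hne (by rw [hf.deg]; exact boxP_deg d hd c)
  have hfil := fil2_of_tot (f := f) (boxP d c) (2 * d - 1) (boxP_tot d c)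
  rw [← mk_eq_ev2] at hfil
  have hb := bezout_smooth hf (2 * d - 1) _ hmk hfil (ι := Unit)
    (fun _ => (0, PowerSeries.constantCoeff Y)) (fun _ _ _ => rfl) (fun _ => θ)
    (fun _ => d * (2 * d - 1) + 1) (fun _ => by simp [hθ1]) (fun _ => by simp [hθ2]) (fun _ => by
      rw [mk_eq_ev2, map_ev2, hθ1, hθ2, boxP_ev2, PowerSeries.X_pow_dvd_iff]
      intro m hm
      have := congrFun hc ⟨m, hm⟩
      simpa using this)
  simp at hb

end Indep

section NewtonDeg
variable {σ K : Type*} [Field K]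

/-- power series whose `j`th coefficient has degree at most `j` -/
def degB (σ K : Type*) [Field K] : Subring (PowerSeries (MvPolynomial σ K)) where
  carrier := {W | ∀ j, (PowerSeries.coeff j W).totalDegree ≤ j}
  mul_mem' := by
    intro a b ha hb j
    rw [PowerSeries.coeff_mul]
    refine MvPolynomial.totalDegree_finsetSum_le fun x hx => ?_
    rw [Finset.HasAntidiagonal.mem_antidiagonal] at hx
    refine (MvPolynomial.totalDegree_mul _ _).trans ?_
    have := ha x.1
    have := hb x.2
    omega
  one_mem' := by
    intro j
    rw [PowerSeries.coeff_one]
    split_ifs <;> simp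
  add_mem' := by
    intro a b ha hb j
    rw [map_add]
    exact (MvPolynomial.totalDegree_add _ _).trans (max_le (ha j) (hb j))
  zero_mem' := by intro j; simp
  neg_mem' := by
    intro a ha j
    rw [map_neg, MvPolynomial.totalDegree_neg]; exact ha j

lemma degB_C (c : K) : PowerSeries.C (MvPolynomial.C c) ∈ degB σ K := by
  intro j
  rw [PowerSeries.coeff_C]
  split_ifs <;> simp

lemma degB_X : (PowerSeries.X : PowerSeries (MvPolynomial σ K)) ∈ degB σ K := by
  intro j
  rw [PowerSeries.coeff_X]
  split_ifs <;> simp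

lemma degB_uX (i : σ) : PowerSeries.C (MvPolynomial.X i) * PowerSeries.X ∈ degB σ K := by
  intro j
  rw [PowerSeries.coeff_C_mul, PowerSeries.coeff_X]
  split_ifs with h
  · subst h; simp
  · simp

lemma newton_degB (f : (PowerSeries (MvPolynomial σ K))[X]) (Y : PowerSeries (MvPolynomial σ K))
    (hY : f.eval Y = 0) (hf : ∀ W ∈ degB σ K, f.eval W ∈ degB σ K) (y0 c : K)
    (hY0 : PowerSeries.constantCoeff Y = MvPolynomial.C y0)
    (hc : PowerSeries.constantCoeff (f.derivative.eval (PowerSeries.C (MvPolynomial.C y0)))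
      * MvPolynomial.C c = 1) : Y ∈ degB σ K := by
  have key : ∀ n : ℕ, ∃ W ∈ degB σ K, PowerSeries.X ^ (n + 1) ∣ Y - W := by
    intro n
    induction n with
    | zero =>
      refine ⟨PowerSeries.C (MvPolynomial.C y0), degB_C _, ?_⟩
      rw [zero_add, pow_one, PowerSeries.X_dvd_iff]
      simp [hY0]
    | succ n ih =>
      obtain ⟨W, hW, hd⟩ := ih
      refine ⟨W - PowerSeries.C (MvPolynomial.C c) * f.eval W,
        Subring.sub_mem _ hW (Subring.mul_mem _ (degB_C _) (hf W hW)), ?_⟩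
      obtain ⟨z, hz⟩ := f.binomExpansion W (Y - W)
      rw [add_sub_cancel, hY] at hz
      have h1 : Y - (W - PowerSeries.C (MvPolynomial.C c) * f.eval W) =
          (Y - W) * (1 - PowerSeries.C (MvPolynomial.C c) * f.derivative.eval W
            - PowerSeries.C (MvPolynomial.C c) * z * (Y - W)) := by
        linear_combination -PowerSeries.C (MvPolynomial.C c) * hz
      rw [h1, pow_succ]
      have hX : PowerSeries.X ∣ Y - W := (dvd_pow_self _ (Nat.succ_ne_zero n)).trans hd
      refine mul_dvd_mul hd (dvd_sub ?_ (hX.mul_left _))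
      rw [PowerSeries.X_dvd_iff] at hX ⊢
      have hW0 : PowerSeries.constantCoeff W = MvPolynomial.C y0 := by
        rw [← hY0]; rw [map_sub, sub_eq_zero] at hX; exact hX.symm
      have h2 : ∀ V : PowerSeries (MvPolynomial σ K), PowerSeries.constantCoeff (f.derivative.eval V) =
          (f.derivative.map PowerSeries.constantCoeff).eval (PowerSeries.constantCoeff V) := by
        intro V; rw [Polynomial.eval_map_apply]
      rw [map_sub, map_mul, h2, hW0]
      rw [h2] at hc
      simp at hc ⊢
      rw [mul_comm, hc, sub_self]
  intro j
  obtain ⟨W, hW, hd⟩ := key j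
  rw [PowerSeries.X_pow_dvd_iff] at hd
  have := hd j (by omega)
  rw [map_sub, sub_eq_zero] at this
  rw [this]; exact hW j

end NewtonDeg
end LineAvoid

namespace LineAvoid
open Polynomial

lemma eval_map_C_one {σ R S : Type*} [CommRing R] [CommRing S] (φ : R →+* S) (P : MvPolynomial σ R)
    (v : σ → R) (hv : MvPolynomial.eval v P = 1) :
    MvPolynomial.eval (fun i => φ (v i)) (MvPolynomial.map φ P) = 1 := by
  rw [MvPolynomial.eval_map]
  have := MvPolynomial.eval₂_comp_left φ (RingHom.id R) v P
  rw [RingHom.comp_id] at this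
  have h2 : MvPolynomial.eval₂ (RingHom.id R) v P = 1 := hv
  rw [h2, map_one] at this
  exact this.symm

lemma lineP_monic {σ R : Type*} [CommRing R] [Nontrivial R] (P : MvPolynomial σ R) {d : ℕ}
    (hP : P.IsHomogeneous d) (v p u : σ → R) (hv : MvPolynomial.eval v P = 1) :
    (lineP P v p u).Monic ∧ (lineP P v p u).natDegree = d := by
  have h := lineP_coeff_deg P hP v p u
  rw [hv, C_1] at h
  refine ⟨monic_of_natDegree_le_of_coeff_eq_one d h.1 h.2, le_antisymm h.1 ?_⟩
  exact le_natDegree_of_ne_zero (by rw [h.2]; exact one_ne_zero)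

section Generic
variable {σ : Type*} {K : Type*} [Field K]

/-- the line through generic direction -/
noncomputable def genP (P : MvPolynomial σ K) (v p : σ → K) : (MvPolynomial σ K)[X][X] :=
  lineP (MvPolynomial.map MvPolynomial.C P) (fun i => MvPolynomial.C (v i))
    (fun i => MvPolynomial.C (p i)) MvPolynomial.X

lemma genP_irr (P : MvPolynomial σ K) {d : ℕ} (hP : Irreducible P) (hhom : P.IsHomogeneous d)
    (v p : σ → K) (hv : MvPolynomial.eval v P = 1) : Irreducible (genP P v p) := by
  have hmon := (lineP_monic (MvPolynomial.map (MvPolynomial.C (σ := σ)) P) (hhom.map _)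
    (fun i => MvPolynomial.C (v i)) (fun i => MvPolynomial.C (p i)) MvPolynomial.X
    (eval_map_C_one _ P v hv)).1
  refine Monic.irreducible_of_irreducible_map (evalRingHom (1 : MvPolynomial σ K)) _ hmon ?_
  rw [genP, lineP_eval]
  convert shP_irreducible v p P hP using 2
  funext i
  ring

lemma genP_curve (P : MvPolynomial σ K) {d : ℕ} (hP : Irreducible P) (hhom : P.IsHomogeneous d)
    (v p : σ → K) (hv : MvPolynomial.eval v P = 1) :
    IsCurve ((genP P v p).map (mapRingHom (algebraMap (MvPolynomial σ K)
      (FractionRing (MvPolynomial σ K))))) d := by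
  obtain ⟨ι, hι⟩ : ∃ ι, ι = algebraMap (MvPolynomial σ K) (FractionRing (MvPolynomial σ K)) := ⟨_, rfl⟩
  rw [← hι]
  have hv1 := eval_map_C_one (MvPolynomial.C (σ := σ)) P v hv
  have hmon := (lineP_monic (MvPolynomial.map (MvPolynomial.C (σ := σ)) P) (hhom.map _)
    (fun i => MvPolynomial.C (v i)) (fun i => MvPolynomial.C (p i)) MvPolynomial.X hv1).1
  have hL := lineP_monic (MvPolynomial.map ι (MvPolynomial.map (MvPolynomial.C (σ := σ)) P))
    ((hhom.map _).map _)
    (fun i => ι (MvPolynomial.C (v i))) (fun i => ι (MvPolynomial.C (p i)))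
    (fun i => ι (MvPolynomial.X i)) (eval_map_C_one ι _ _ hv1)
  have htot := lineP_tot (MvPolynomial.map ι (MvPolynomial.map (MvPolynomial.C (σ := σ)) P))
    ((hhom.map _).map _)
    (fun i => ι (MvPolynomial.C (v i))) (fun i => ι (MvPolynomial.C (p i)))
    (fun i => ι (MvPolynomial.X i))
  rw [← lineP_map] at hL htot
  refine ⟨hL.1, hL.2, htot, ?_⟩
  have hM : Irreducible ((genP P v p).map (algebraMap (MvPolynomial σ K)[X]
      (FractionRing (MvPolynomial σ K)[X]))) :=
    (Monic.irreducible_iff_irreducible_map_fraction_map hmon).1 (genP_irr P hP hhom v p hv)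
  have hinj : Function.Injective ((algebraMap (MvPolynomial σ K)[X]
      (FractionRing (MvPolynomial σ K)[X])).comp C) := by
    rw [RingHom.coe_comp]
    exact (IsFractionRing.injective _ _).comp C_injective
  let ψ : (FractionRing (MvPolynomial σ K))[X] →+* FractionRing (MvPolynomial σ K)[X] :=
    eval₂RingHom (IsFractionRing.lift hinj) (algebraMap (MvPolynomial σ K)[X] _ X)
  have hψ : ψ.comp (mapRingHom ι) = algebraMap (MvPolynomial σ K)[X]
      (FractionRing (MvPolynomial σ K)[X]) := by
    apply Polynomial.ringHom_ext
    · intro a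
      simp [ψ, hι]
    · simp [ψ]
  refine Monic.irreducible_of_irreducible_map ψ _ hL.1 ?_
  rw [Polynomial.map_map, hψ]
  exact hM

end Generic

lemma irr_of_indep {K : Type*} [Field K] {f : K[X][X]} {d : ℕ} (hf : f.Monic) (hd : f.natDegree = d)
    (hd0 : 0 < d)
    (htot : ∀ i j, d < i + j → (f.coeff j).coeff i = 0) (Y : PowerSeries K)
    (hY : ev2 f (PowerSeries.X : PowerSeries K) Y = 0)
    (hind : ∀ c : Fin (d + 1) × Fin d → K, (∑ r, c r • ((PowerSeries.X : PowerSeries K) ^ (r.1 : ℕ) *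
      Y ^ (r.2 : ℕ)) = 0) → c = 0) : Irreducible f := by
  rw [hf.irreducible_iff_natDegree']
  refine ⟨?_, ?_⟩
  · rintro rfl; simp at hd; omega
  intro a b ha hb hab hmem
  rw [Finset.mem_Ioc, hd] at hmem
  have hdeg : a.natDegree + b.natDegree = d := by rw [← hd, ← hab, ha.natDegree_mul hb]
  have key : ∀ a b : K[X][X], a.Monic → a * b = f → a.natDegree < d →
      ev2 a (PowerSeries.X : PowerSeries K) Y ≠ 0 := by
    intro a b ha hab had h0
    have ht := tdeg_factor a b f hab hf.ne_zero d (fun i j hi => htot i j (by omega))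
    have hbox : a = boxP d (fun r => (a.coeff r.2).coeff r.1) := by
      ext j i
      by_cases hj : j < d
      · by_cases hi : i < d + 1
        · exact (boxP_coeff d (fun r => (a.coeff r.2).coeff r.1) (⟨i, hi⟩, ⟨j, hj⟩)).symm
        · rw [ht i j (by omega)]
          rw [boxP, finsetSum_coeff, finsetSum_coeff]
          symm
          refine Finset.sum_eq_zero fun r _ => ?_
          rw [coeff_monomial]
          split_ifs with h
          · rw [coeff_monomial, if_neg]
            have h1 := r.1.2
            omega
          · simp
      · rw [coeff_eq_zero_of_natDegree_lt (p := a) (by omega),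
          coeff_eq_zero_of_natDegree_lt (p := boxP d _) (lt_of_lt_of_le (boxP_deg d hd0 _) (by omega))]
    rw [hbox, boxP_ev2] at h0
    have hc := hind _ h0
    apply ha.ne_zero
    rw [hbox, hc]
    simp [boxP]
  have h0 : ev2 a (PowerSeries.X : PowerSeries K) Y * ev2 b (PowerSeries.X : PowerSeries K) Y = 0 := by
    rw [← hY, ← hab, ev2, ev2, ev2, eval₂_mul]
  rcases mul_eq_zero.1 h0 with h | h
  · exact key a b ha hab (by omega) h
  · exact key b a hb (by rw [mul_comm]; exact hab) (by omega) h

end LineAvoid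

namespace LineAvoid
open Polynomial
section
variable {σ : Type*} [Fintype σ] {k K : Type*} [Field k] [Fintype k] [Field K] [Algebra k K]

/-- the substitution homomorphism to power series -/
noncomputable def psv (R : Type*) [CommRing R] : R[X] →+* PowerSeries R :=
  eval₂RingHom (PowerSeries.C (R := R)) PowerSeries.X

lemma psv_map {R S : Type*} [CommRing R] [CommRing S] (φ : R →+* S) :
    (PowerSeries.map φ).comp (psv R) = (psv S).comp (mapRingHom φ) := by
  apply Polynomial.ringHom_ext
  · intro a; simp [psv]
  · simp [psv]

lemma root_map {R S : Type*} [CommRing R] [CommRing S] (φ : R →+* S) (f : R[X][X])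
    (Y : PowerSeries R) (h : f.eval₂ (psv R) Y = 0) :
    (f.map (mapRingHom φ)).eval₂ (psv S) (PowerSeries.map φ Y) = 0 := by
  rw [eval₂_map, ← psv_map, ← hom_eval₂, h, map_zero]

lemma ev2_psv {L : Type*} [Field L] (f : L[X][X]) (Y : PowerSeries L) :
    ev2 f (PowerSeries.X : PowerSeries L) Y = f.eval₂ (psv L) Y := by
  rw [ev2]
  congr 1

lemma genP_root (P : MvPolynomial σ K) {d : ℕ} (hhom : P.IsHomogeneous d)
    (v p : σ → K) (hv : MvPolynomial.eval v P = 1) (y0 : K) (hy : (shP P v p).eval y0 = 0)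
    (hy' : (derivative (shP P v p)).eval y0 ≠ 0) :
    ∃ Y ∈ degB σ K, (genP P v p).eval₂ (psv _) Y = 0 ∧
      PowerSeries.constantCoeff Y = MvPolynomial.C y0 := by
  have hv1 := eval_map_C_one (MvPolynomial.C (σ := σ)) P v hv
  have hmon := (lineP_monic (MvPolynomial.map (MvPolynomial.C (σ := σ)) P) (hhom.map _)
    (fun i => MvPolynomial.C (v i)) (fun i => MvPolynomial.C (p i)) MvPolynomial.X hv1).1
  have h0 : (genP P v p).map (evalRingHom 0) = (shP P v p).map MvPolynomial.C := by
    rw [genP, lineP_eval, shP_map]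
    congr 1
    funext i; simp
  have hd : ((genP P v p).map (evalRingHom 0)).derivative.eval (MvPolynomial.C y0) =
      MvPolynomial.C ((derivative (shP P v p)).eval y0) := by
    rw [h0, derivative_map, eval_map_apply]
  obtain ⟨Y, hY0, hY⟩ := exists_hensel_root (genP P v p) hmon 0 (MvPolynomial.C y0)
    (by rw [h0, eval_map_apply, hy, map_zero])
    (by rw [hd]; exact (isUnit_iff_ne_zero.2 hy').map _)
  have hps : (eval₂RingHom (PowerSeries.C (R := MvPolynomial σ K)) (PowerSeries.C 0 + PowerSeries.X))
      = psv _ := by rw [psv, map_zero, zero_add]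
  rw [hps] at hY
  refine ⟨Y, ?_, by rwa [eval_map] at hY, hY0⟩
  refine newton_degB ((genP P v p).map (psv _)) Y hY ?_ y0 ((derivative (shP P v p)).eval y0)⁻¹ hY0 ?_
  · intro W hW
    rw [genP, lineP, shP_map, shP_eval, MvPolynomial.map_map, MvPolynomial.map_map,
      MvPolynomial.eval_map]
    apply MvPolynomial.eval₂_mem
    · intro m _
      simp only [RingHom.coe_comp, Function.comp_apply]
      simpa [psv] using degB_C (σ := σ) _
    · intro i
      have h1 : psv (MvPolynomial σ K) (C (MvPolynomial.C (v i))) = PowerSeries.C (MvPolynomial.C (v i)) := by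
        simp [psv]
      have h2 : psv (MvPolynomial σ K) (C (MvPolynomial.C (p i)) + C (MvPolynomial.X i) * X) =
          PowerSeries.C (MvPolynomial.C (p i)) + PowerSeries.C (MvPolynomial.X i) * PowerSeries.X := by
        simp [psv]
      rw [h1, h2]
      exact Subring.add_mem _ (Subring.mul_mem _ (degB_C _) hW)
        (Subring.add_mem _ (degB_C _) (degB_uX i))
  · have hc : (PowerSeries.constantCoeff (R := MvPolynomial σ K)).comp (psv _) = evalRingHom 0 := by
      apply Polynomial.ringHom_ext
      · intro a; simp [psv]
      · simp [psv]
    rw [derivative_map, ← eval_map_apply, Polynomial.map_map, hc, ← derivative_map,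
      PowerSeries.constantCoeff_C, hd, ← map_mul, mul_inv_cancel₀ hy', map_one]

lemma coeff_psmap {R S : Type*} [CommRing R] [CommRing S] (φ : R →+* S) (Y : PowerSeries R) (i j m : ℕ) :
    φ (PowerSeries.coeff m ((PowerSeries.X : PowerSeries R) ^ i * Y ^ j)) =
      PowerSeries.coeff m ((PowerSeries.X : PowerSeries S) ^ i * (PowerSeries.map φ Y) ^ j) := by
  have : (PowerSeries.X : PowerSeries S) ^ i * (PowerSeries.map φ Y) ^ j =
      PowerSeries.map φ ((PowerSeries.X : PowerSeries R) ^ i * Y ^ j) := by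
    simp
  rw [this, PowerSeries.coeff_map]

lemma exists_u (P : MvPolynomial σ K) {d : ℕ} (hP : Irreducible P) (hhom : P.IsHomogeneous d)
    (hd : 0 < d)
    (v p : σ → K) (hv : MvPolynomial.eval v P = 1) (y0 : K) (hy : (shP P v p).eval y0 = 0)
    (hy' : (derivative (shP P v p)).eval y0 ≠ 0)
    (hq : ((d + 1) * d) * (d * (2 * d - 1)) < Fintype.card k) :
    ∃ u : σ → k, IsCurve (lineP P v p (fun i => algebraMap k K (u i))) d ∧
      derivative (lineP P v p (fun i => algebraMap k K (u i))) ≠ 0 := by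
  obtain ⟨Y, hYB, hYr, hY0⟩ := genP_root P hhom v p hv y0 hy hy'
  obtain ⟨ι, hι⟩ : ∃ ι, ι = algebraMap (MvPolynomial σ K) (FractionRing (MvPolynomial σ K)) := ⟨_, rfl⟩
  have hιinj : Function.Injective ι := hι ▸ IsFractionRing.injective _ _
  have hcurve := genP_curve P hP hhom v p hv
  rw [← hι] at hcurve
  let M : Matrix (Fin (d + 1) × Fin d) (Fin (d * (2 * d - 1) + 1)) (MvPolynomial σ K) :=
    Matrix.of fun r m => PowerSeries.coeff (m : ℕ)
      ((PowerSeries.X : PowerSeries (MvPolynomial σ K)) ^ (r.1 : ℕ) * Y ^ (r.2 : ℕ))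
  have hMdeg : ∀ r m, (M r m).totalDegree ≤ d * (2 * d - 1) := by
    intro r m
    have h1 : (PowerSeries.X : PowerSeries (MvPolynomial σ K)) ^ (r.1 : ℕ) * Y ^ (r.2 : ℕ) ∈ degB σ K :=
      Subring.mul_mem _ (Subring.pow_mem _ degB_X _) (Subring.pow_mem _ hYB _)
    exact (h1 m).trans (by have := m.2; omega)
  have hind := curve_indep hcurve hd (PowerSeries.map ι Y) (by
    rw [ev2_psv]; exact root_map ι _ Y hYr)
  obtain ⟨g, hg⟩ := exists_minor (M.map ι) (by
    convert hind using 1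
    funext r m
    exact coeff_psmap ι Y _ _ _)
  have hdet : (M.submatrix id g).det ≠ 0 := by
    intro h0
    apply hg
    have := RingHom.map_det ι (M.submatrix id g)
    rw [h0, map_zero] at this
    exact this.symm
  have hdeg := totalDegree_det_le (M.submatrix id g) (d * (2 * d - 1)) (fun i j => hMdeg _ _)
  rw [Fintype.card_prod, Fintype.card_fin, Fintype.card_fin] at hdeg
  obtain ⟨u, hu⟩ := exists_rational_ne (k := k) _ hdet (hdeg.trans_lt hq)
  refine ⟨u, ?_⟩
  obtain ⟨ε, hε⟩ : ∃ ε : MvPolynomial σ K →+* K, ε = MvPolynomial.eval (fun i => algebraMap k K (u i)) :=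
    ⟨_, rfl⟩
  rw [← hε] at hu
  have hfu : (genP P v p).map (mapRingHom ε) = lineP P v p (fun i => algebraMap k K (u i)) := by
    rw [genP, lineP_map, MvPolynomial.map_map]
    have : ε.comp MvPolynomial.C = RingHom.id K := by ext; simp [hε]
    rw [this, MvPolynomial.map_id]
    simp [hε]
  have hm := lineP_monic P hhom v p (fun i => algebraMap k K (u i)) hv
  have ht := lineP_tot P hhom v p (fun i => algebraMap k K (u i))
  have hroot := root_map ε _ Y hYr
  rw [hfu, ← ev2_psv] at hroot
  refine ⟨⟨hm.1, hm.2, ht, ?_⟩, ?_⟩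
  · refine irr_of_indep hm.1 hm.2 hd ht (PowerSeries.map ε Y) hroot ?_
    intro c hc
    refine rows_indep_of_minor (M.map ε) g ?_ c ?_
    · rw [RingHom.map_det] at hu
      exact hu
    · intro m
      have := congrArg (PowerSeries.coeff (m : ℕ)) hc
      rw [map_sum, map_zero] at this
      rw [← this]
      refine Finset.sum_congr rfl fun r _ => ?_
      rw [PowerSeries.coeff_smul, smul_eq_mul, ← coeff_psmap]
      rfl
  · intro h0
    have h1 := lineP_eval P v p (fun i => algebraMap k K (u i)) 0
    have h2 := congrArg derivative h1
    rw [derivative_map, h0] at h2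
    apply hy'
    have h3 : (fun i => p i + algebraMap k K (u i) * 0) = p := by funext i; simp
    rw [h3] at h2
    rw [← h2]; simp

theorem bertini [IsAlgClosed K] (P : MvPolynomial σ K) {d : ℕ} (hP : Irreducible P)
    (hhom : P.IsHomogeneous d) (hd : 0 < d)
    (v : σ → K) (hv : MvPolynomial.eval v P = 1)
    (hD : ∑ i, MvPolynomial.C (v i) * MvPolynomial.pderiv i P ≠ 0)
    (hq1 : 2 * d * d < Fintype.card k)
    (hq2 : ((d + 1) * d) * (d * (2 * d - 1)) < Fintype.card k) :
    ∃ p u : σ → k, IsCurve (lineP P v (fun i => algebraMap k K (p i))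
        (fun i => algebraMap k K (u i))) d ∧
      derivative (lineP P v (fun i => algebraMap k K (p i)) (fun i => algebraMap k K (u i))) ≠ 0 := by
  obtain ⟨p, hp⟩ := exists_p (k := k) P hP hhom v hv hD hq1
  have hdc := shP_deg_coeff P hhom v (fun i => algebraMap k K (p i))
  obtain ⟨y0, hy0⟩ := IsAlgClosed.exists_root (shP P v (fun i => algebraMap k K (p i))) (by
    intro h
    have := le_natDegree_of_ne_zero (p := shP P v (fun i => algebraMap k K (p i))) (n := d)
      (by rw [hdc.2, hv]; exact one_ne_zero)
    rw [natDegree_eq_zero_iff_degree_le_zero.2 h.le] at this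
    omega)
  obtain ⟨u, hu⟩ := exists_u (k := k) P hP hhom hd v _ hv y0 hy0 (hp y0 hy0) hq2
  exact ⟨p, u, hu⟩
end
end LineAvoid

namespace LineAvoid
open Polynomial

lemma q_bounds (d q : ℕ) (hd : 4 ≤ d)
    (hq : (q : ℝ) > ((1 + Real.sqrt 2) / 2) ^ 2 * (d : ℝ) ^ 2 * ((d : ℝ) - 1) ^ 2 * ((d : ℝ) - 2) ^ 2) :
    d + 1 < q ∧ 2 * d * d < q ∧ ((d + 1) * d) * (d * (2 * d - 1)) < q := by
  obtain ⟨e, rfl⟩ : ∃ e, d = e + 4 := ⟨d - 4, by omega⟩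
  have h1 : (1 : ℝ) ≤ ((1 + Real.sqrt 2) / 2) ^ 2 := by
    have : (1 : ℝ) ≤ Real.sqrt 2 := by
      rw [Real.one_le_sqrt]; norm_num
    nlinarith
  have h2 : (q : ℝ) > ((e + 4) ^ 2 * (e + 3) ^ 2 * (e + 2) ^ 2 : ℕ) := by
    refine lt_of_le_of_lt ?_ hq
    push_cast
    have h3 : (0 : ℝ) ≤ ((e : ℝ) + 4) ^ 2 * (e + 3) ^ 2 * (e + 2) ^ 2 := by positivity
    have h4 : ((1 + Real.sqrt 2) / 2) ^ 2 * ((e : ℝ) + 4) ^ 2 * ((e : ℝ) + 4 - 1) ^ 2 * ((e : ℝ) + 4 - 2) ^ 2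
      = ((1 + Real.sqrt 2) / 2) ^ 2 * (((e : ℝ) + 4) ^ 2 * (e + 3) ^ 2 * (e + 2) ^ 2) := by ring
    rw [h4]
    exact le_mul_of_one_le_left h3 h1
  have h3 : (e + 4) ^ 2 * (e + 3) ^ 2 * (e + 2) ^ 2 < q := by exact_mod_cast h2
  have h5 : (e + 5) * (2 * e + 7) ≤ (e + 3) ^ 2 * (e + 2) ^ 2 := by
    have : (e + 3) ^ 2 * (e + 2) ^ 2 = (e + 5) * (2 * e + 7) + (e ^ 4 + 10 * e ^ 3 + 35 * e ^ 2 + 43 * e + 1) := by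
      ring
    omega
  have h6 := Nat.mul_le_mul_left ((e + 4) ^ 2) h5
  have h7 : (e + 4 + 1) * (e + 4) * ((e + 4) * (2 * (e + 4) - 1)) = (e + 4) ^ 2 * ((e + 5) * (2 * e + 7)) := by
    have : 2 * (e + 4) - 1 = 2 * e + 7 := by omega
    rw [this]; ring
  have h8 : (e + 4 + 1) * (e + 4) * ((e + 4) * (2 * (e + 4) - 1)) < q := by
    rw [h7]; rw [mul_assoc] at h3; omega
  have h9 : 2 * (e + 4) * (e + 4) ≤ (e + 4) ^ 2 * ((e + 5) * (2 * e + 7)) := by nlinarith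
  have h10 : e + 4 + 1 ≤ 2 * (e + 4) * (e + 4) := by nlinarith
  rw [h7] at h8
  refine ⟨by omega, by omega, ?_⟩
  rw [h7]; exact h8

lemma eval_smul_hom {σ R : Type*} [CommRing R] (P : MvPolynomial σ R) {d : ℕ} (hP : P.IsHomogeneous d)
    (c : R) (x : σ → R) : MvPolynomial.eval (c • x) P = c ^ d * MvPolynomial.eval x P := by
  rw [MvPolynomial.eval_eq, MvPolynomial.eval_eq, Finset.mul_sum]
  refine Finset.sum_congr rfl fun m hm => ?_
  have hd : ∑ i ∈ m.support, m i = d := by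
    have := hP (MvPolynomial.mem_support_iff.1 hm)
    rw [← this, Finsupp.weight_apply, Finsupp.sum]; simp
  simp only [Pi.smul_apply, smul_eq_mul, mul_pow]
  rw [Finset.prod_mul_distrib, Finset.prod_pow_eq_pow_sum, hd]
  ring

lemma card_le_of_roots {k ι : Type*} [Field k] (S : Finset ι) (φ : ι → k)
    (hφ : Set.InjOn φ S) (f : k[X]) (hf : f ≠ 0) {d : ℕ} (hd : f.natDegree ≤ d)
    (h : ∀ s ∈ S, f.eval (φ s) = 0) : S.card ≤ d := by
  classical
  rw [← Finset.card_image_of_injOn hφ]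
  refine le_trans (Finset.card_le_card (t := f.roots.toFinset) ?_) ?_
  · intro y hy
    obtain ⟨s, hs, rfl⟩ := Finset.mem_image.1 hy
    rw [Multiset.mem_toFinset, mem_roots hf]
    exact h s hs
  · exact (Multiset.toFinset_card_le _).trans ((card_roots' f).trans hd)

lemma lineP_eval_line {σ R : Type*} [CommRing R] (P : MvPolynomial σ R) (v p u : σ → R) (α β : R) :
    (lineP P v p u).eval (C α * X + C β) = shP P (fun i => α * v i + u i) (fun i => β * v i + p i) := by
  rw [lineP, shP_eval, MvPolynomial.eval_map, shP]
  congr 1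
  funext i
  simp
  ring

theorem core {σ : Type*} [Fintype σ] {k K : Type*} [Field k] [Fintype k] [Field K] [Algebra k K]
    [IsAlgClosed K] (P : MvPolynomial σ k) (d : ℕ) (hd : 4 ≤ d) (hhom : P.IsHomogeneous d)
    (hirr : Irreducible (MvPolynomial.map (algebraMap k K) P))
    (v : σ → k) (hv : MvPolynomial.eval v P = 1)
    (hD : ∑ i, MvPolynomial.C (algebraMap k K (v i)) *
      MvPolynomial.pderiv i (MvPolynomial.map (algebraMap k K) P) ≠ 0)
    (hq : (Fintype.card k : ℝ) >
      ((1 + Real.sqrt 2) / 2) ^ 2 * (d : ℝ) ^ 2 * ((d : ℝ) - 1) ^ 2 * ((d : ℝ) - 2) ^ 2) :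
    ∃ V W : σ → k, ∀ a b : k, (a, b) ≠ (0, 0) → MvPolynomial.eval (a • V + b • W) P ≠ 0 := by
  classical
  by_contra! hcon
  obtain ⟨hq1, hq2, hq3⟩ := q_bounds d _ hd hq
  obtain ⟨p, u, hC, hder⟩ := bertini (k := k) (K := K) _ hirr (hhom.map _) (by omega)
    (fun i => algebraMap k K (v i)) (eval_map_C_one _ P v hv) hD hq2 hq3
  rw [← lineP_map] at hC hder
  obtain ⟨g, hg⟩ : ∃ g, g = lineP P v p u := ⟨_, rfl⟩
  have hgx : ∀ x, g.map (evalRingHom x) = shP P v (fun i => p i + u i * x) := fun x => by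
    rw [hg, lineP_eval]
  have hgl : ∀ α β, g.eval (C α * X + C β) =
      shP P (fun i => α * v i + u i) (fun i => β * v i + p i) := fun α β => by
    rw [hg, lineP_eval_line]
  rw [← hg] at hC hder
  have hshv : ∀ w, shP P v w ≠ 0 := by
    intro w h0
    have := (shP_deg_coeff P hhom v w).2
    rw [h0, hv] at this
    simp at this
  obtain ⟨Z, hZ⟩ : ∃ Z : Finset (k × k), Z = Finset.univ.filter fun z => fval g z.1 z.2 = 0 := ⟨_, rfl⟩
  have hZm : ∀ z, z ∈ Z ↔ fval g z.1 z.2 = 0 := fun z => by simp [hZ]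
  obtain ⟨Bad, hBad⟩ : ∃ Bad : Finset k, Bad = Finset.univ.filter fun α => (shP P v u).eval α = 0 :=
    ⟨_, rfl⟩
  have hcomb := comb_lines Z d Bad ?_ (by omega) ?_ ?_ ?_
  · have hcard := card_points_le g hC (by omega) hder ⌈Real.sqrt (Fintype.card k)⌉₊ (by
      have h1 := Nat.le_ceil (Real.sqrt (Fintype.card k : ℝ))
      have h2 : (Fintype.card k : ℝ) ≤ (⌈Real.sqrt (Fintype.card k)⌉₊ : ℝ) ^ 2 := by
        calc (Fintype.card k : ℝ) = Real.sqrt (Fintype.card k) ^ 2 :=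
              (Real.sq_sqrt (by positivity)).symm
          _ ≤ _ := by gcongr
      exact_mod_cast h2) Z (fun z hz => (hZm z).1 hz)
    exact final_numeric d _ Z.card _ hd hq rfl hcard hcomb.1 hcomb.2
  · refine card_le_of_roots Bad id (fun _ _ _ _ h => h) _ (hshv u) (shP_deg_coeff P hhom v u).1 ?_
    intro s hs
    rw [hBad, Finset.mem_filter] at hs
    exact hs.2
  · intro x0
    refine card_le_of_roots _ Prod.snd ?_ (shP P v (fun i => p i + u i * x0)) (hshv _)
      (shP_deg_coeff P hhom _ _).1 ?_
    · intro z hz z' hz' h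
      rw [Finset.mem_coe, Finset.mem_filter] at hz hz'
      exact Prod.ext (hz.2.trans hz'.2.symm) h
    · intro z hz
      rw [Finset.mem_filter, hZm, fval, hgx, hz.2] at hz
      exact hz.1
  · intro α β
    have hline : ∀ x, (g.eval (C α * X + C β)).eval x = fval g x (α * x + β) := by
      intro x
      rw [fval]
      have := eval_map_apply (f := evalRingHom x) (p := g) (x := C α * X + C β)
      simp only [coe_evalRingHom, eval_add, eval_mul, eval_C, eval_X] at this
      exact this.symm
    refine card_le_of_roots _ Prod.fst ?_ (g.eval (C α * X + C β)) ?_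
      (by rw [hgl]; exact (shP_deg_coeff P hhom _ _).1) ?_
    · intro z hz z' hz' h
      rw [Finset.mem_coe, Finset.mem_filter] at hz hz'
      refine Prod.ext h ?_
      have h1 := hz.2.trans hz'.2.symm
      rw [h] at h1
      exact sub_left_injective h1
    · intro h0
      have hroot : (g.map (mapRingHom (algebraMap k K))).IsRoot
          ((mapRingHom (algebraMap k K)) (C α * X + C β)) := by
        rw [IsRoot, eval_map_apply, h0, map_zero]
      obtain ⟨b, hb⟩ := dvd_iff_isRoot.2 hroot
      have hdeg := hC.deg
      rcases hC.irr.isUnit_or_isUnit hb with h | h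
      · exact not_isUnit_X_sub_C _ h
      · rw [hb, natDegree_mul (X_sub_C_ne_zero _) h.ne_zero, natDegree_X_sub_C,
          natDegree_eq_zero_of_isUnit h] at hdeg
        omega
    · intro z hz
      rw [Finset.mem_filter, hZm] at hz
      rw [hline, ← hz.2]
      convert hz.1 using 2
      ring
  · intro α hα β
    obtain ⟨a, b, hab, h0⟩ := hcon (fun i => β * v i + p i) (fun i => α * v i + u i)
    by_cases ha : a = 0
    · exfalso
      have hb : b ≠ 0 := by
        rintro rfl; exact hab (by rw [ha])
      rw [ha, zero_smul, zero_add, eval_smul_hom P hhom] at h0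
      apply hα
      rw [hBad, Finset.mem_filter, shP_eval]
      refine ⟨Finset.mem_univ _, ?_⟩
      have := (mul_eq_zero.1 h0).resolve_left (pow_ne_zero _ hb)
      have he : (fun i => v i * α + u i) = fun i => α * v i + u i := by
        funext i; ring
      rw [he]; exact this
    · refine ⟨(b / a, α * (b / a) + β), ?_, by simp⟩
      rw [hZm, fval, hgx, shP_eval]
      have h1 : a • (fun i => β * v i + p i) + b • (fun i => α * v i + u i) =
          a • (fun i => v i * (α * (b / a) + β) + (p i + u i * (b / a))) := by
        funext i
        simp only [Pi.add_apply, Pi.smul_apply, smul_eq_mul]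
        field_simp
        ring
      rw [h1, eval_smul_hom P hhom] at h0
      exact (mul_eq_zero.1 h0).resolve_left (pow_ne_zero _ ha)

theorem main {σ : Type*} [Fintype σ] {k K : Type*} [Field k] [Fintype k] [Field K] [Algebra k K]
    [IsAlgClosed K] (P : MvPolynomial σ k) (d : ℕ) (hd : 4 ≤ d) (hhom : P.IsHomogeneous d)
    (hirr : Irreducible (MvPolynomial.map (algebraMap k K) P))
    (hq : (Fintype.card k : ℝ) >
      ((1 + Real.sqrt 2) / 2) ^ 2 * (d : ℝ) ^ 2 * ((d : ℝ) - 1) ^ 2 * ((d : ℝ) - 2) ^ 2) :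
    ∃ V W : σ → k, LinearIndependent k ![V, W] ∧
      ∀ a b : k, (a, b) ≠ (0, 0) → MvPolynomial.eval (a • V + b • W) P ≠ 0 := by
  suffices h : ∃ V W : σ → k, ∀ a b : k, (a, b) ≠ (0, 0) → MvPolynomial.eval (a • V + b • W) P ≠ 0 by
    obtain ⟨V, W, h⟩ := h
    refine ⟨V, W, ?_, h⟩
    rw [LinearIndependent.pair_iff]
    intro a b hab
    by_contra hne
    have hne' : (a, b) ≠ (0, 0) := fun h => hne (by simpa using h)
    apply h a b hne'
    have := eval_smul_hom P hhom 0 0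
    rw [zero_smul, zero_pow (by omega), zero_mul] at this
    rw [hab, this]
  obtain ⟨hq1, hq2, hq3⟩ := q_bounds d _ hd hq
  obtain ⟨v, hv, hD⟩ := exists_v (k := k) _ hirr (hhom.map (algebraMap k K)).totalDegree_le hq1
  have hev : MvPolynomial.eval (fun i => algebraMap k K (v i)) (MvPolynomial.map (algebraMap k K) P) =
      algebraMap k K (MvPolynomial.eval v P) := by
    rw [MvPolynomial.eval_map]
    have := MvPolynomial.eval₂_comp_left (algebraMap k K) (RingHom.id k) v P
    rw [RingHom.comp_id] at this
    exact this.symm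
  have hvne : MvPolynomial.eval v P ≠ 0 := by
    intro h0; rw [hev, h0, map_zero] at hv; exact hv rfl
  obtain ⟨c, hc⟩ : ∃ c, c = (MvPolynomial.eval v P)⁻¹ := ⟨_, rfl⟩
  have hc0 : c ≠ 0 := hc ▸ inv_ne_zero hvne
  have hcK : algebraMap k K c ≠ 0 := by simpa using hc0
  have hmap : MvPolynomial.map (algebraMap k K) (MvPolynomial.C c * P) =
      MvPolynomial.C (algebraMap k K c) * MvPolynomial.map (algebraMap k K) P := by
    rw [map_mul, MvPolynomial.map_C]
  obtain ⟨V, W, h⟩ := core (K := K) (MvPolynomial.C c * P) d hd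
    (by simpa using (MvPolynomial.isHomogeneous_C σ c).mul hhom)
    (by
      rw [hmap]
      have hu : IsUnit (MvPolynomial.C (algebraMap k K c) : MvPolynomial σ K) :=
        (isUnit_iff_ne_zero.2 hcK).map _
      exact (irreducible_isUnit_mul hu).2 hirr)
    v (by rw [map_mul, MvPolynomial.eval_C, hc, inv_mul_cancel₀ hvne])
    (by
      rw [hmap]
      have : ∑ i, MvPolynomial.C (algebraMap k K (v i)) *
        MvPolynomial.pderiv i (MvPolynomial.C (algebraMap k K c) *
          MvPolynomial.map (algebraMap k K) P) = MvPolynomial.C (algebraMap k K c) *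
          ∑ i, MvPolynomial.C (algebraMap k K (v i)) *
            MvPolynomial.pderiv i (MvPolynomial.map (algebraMap k K) P) := by
        rw [Finset.mul_sum]
        refine Finset.sum_congr rfl fun i _ => ?_
        rw [MvPolynomial.pderiv_C_mul]; ring
      rw [this]
      exact mul_ne_zero (by simpa using hcK) hD) hq
  refine ⟨V, W, fun a b hab => ?_⟩
  have := h a b hab
  rw [map_mul] at this
  exact right_ne_zero_of_mul this

end LineAvoid

open MvPolynomial

/-- Proposition 2.4: a geometrically irreducible hypersurface of degree `δ ≥ 4` in `ℙⁿ`
over `𝔽_q`, with `q` large compared to `δ`, misses all `𝔽_q`-points of some `𝔽_q`-line. -/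
theorem line_avoiding_rational_points_of_geometrically_irreducible_hypersurface
    (F : Type) [Field F] [Fintype F]
    (n : ℕ) (hn : 2 ≤ n)
    (P : MvPolynomial (Fin (n + 1)) F) (δ : ℕ) (hδ : 4 ≤ δ)
    (hhom : P.IsHomogeneous δ)
    (hirr : Irreducible (map (algebraMap F (AlgebraicClosure F)) P))
    (hq : (Fintype.card F : ℝ) >
      ((1 + Real.sqrt 2) / 2) ^ 2 * (δ : ℝ) ^ 2 * ((δ : ℝ) - 1) ^ 2 * ((δ : ℝ) - 2) ^ 2) :
    ∃ V W : Fin (n + 1) → F, LinearIndependent F ![V, W] ∧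
      ∀ a b : F, (a, b) ≠ (0, 0) → eval (a • V + b • W) P ≠ 0 := by
  exact LineAvoid.main (K := AlgebraicClosure F) P δ hδ hhom hirr hq
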